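/- Assume the random transformation 𝓡 satisfies assumption (A1): there exist ε_o > 0 and a sequence Δ_n → 0 such that P( E[L(𝓡(Z)) − L(Z) | Z] ≥ ε_o ) ≥ 1 − Δ_n. Then for every convex nondecreasing function Φ : ℝ⁺ → ℝ⁺, every sequence of reals μ_n, and every constant c_o with 0 < c_o < √(2α)/(8 b(q)), where α := (1/3) P(Z₁ = 𝐀, Z₃ = 𝐁) and b(q) := √(2π q(1−q)) · exp(1/(2 q(1−q))), the inequality E Φ(|L(Z) − μ_n|) ≥ c_o · Φ( ε_o √(2αn) / 16 ) holds for every sufficiently large n. -/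

import Mathlib

open Finset

noncomputable section

/-- Law of the first `n` terms `(Z₁, …, Z_n)` of a Markov chain with initial
distribution `π` and transition matrix `p`, as a pmf on `Fin n → S`. -/
def chainLaw {S : Type*} (π : S → ℝ) (p : S → S → ℝ) (n : ℕ) (z : Fin n → S) : ℝ :=
  if hn : 0 < n then
    π (z ⟨0, hn⟩) *
      ∏ i : Fin (n - 1),
        p (z ⟨i.1, by have := i.isLt; omega⟩) (z ⟨i.1 + 1, by have := i.isLt; omega⟩)
  else 1

/-- The position of the first letter of the `i`-th triplet (`0`-indexed). -/
def posA (n : ℕ) (i : Fin (n / 3)) : Fin n := ⟨3 * i.1, by have := i.isLt; omega⟩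
/-- The position of the middle letter of the `i`-th triplet. -/
def posM (n : ℕ) (i : Fin (n / 3)) : Fin n := ⟨3 * i.1 + 1, by have := i.isLt; omega⟩
/-- The position of the last letter of the `i`-th triplet. -/
def posB (n : ℕ) (i : Fin (n / 3)) : Fin n := ⟨3 * i.1 + 2, by have := i.isLt; omega⟩

open Classical in
/-- The random transformation `𝓡` as a Markov kernel: it picks, uniformly at random,
one of the `(𝐀·𝐁)`-triplets whose middle letter is not `𝐃`, and replaces that middle
letter by `𝐃` (acting as the identity if there is no such triplet). -/
def kernelR {S : Type*} (A B D : S) (n : ℕ) (z z' : Fin n → S) : ℝ :=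
  let J : Finset (Fin (n / 3)) := univ.filter fun i =>
    z (posA n i) = A ∧ z (posB n i) = B ∧ z (posM n i) ≠ D
  if J.Nonempty then
    ((J.filter fun i => Function.update z (posM n i) D = z').card : ℝ) / J.card
  else if z' = z then 1 else 0

open Classical in
/-- Probability of an event under a pmf on a finite type. -/
def prOf {Ω : Type*} [Fintype Ω] (P : Ω → ℝ) (E : Ω → Prop) : ℝ :=
  ∑ z, if E z then P z else 0

/-- The optimal alignment score of two words `x, y ∈ 𝔸ⁿ`, given a pairwise scoring
function `S` and a gap price `δ`: the maximum over all alignments (pairs of strictly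
increasing index sequences `ρ, τ : Fin k → Fin n`, including the empty one `k = 0`) of
`Σᵢ S(x(ρᵢ), y(τᵢ)) + δ(n - k)`. -/
def alignScore {𝔸 : Type*} (S : 𝔸 → 𝔸 → ℝ) (δ : ℝ) (n : ℕ) (x y : Fin n → 𝔸) : ℝ :=
  sSup {s : ℝ | ∃ (k : ℕ) (ρ τ : Fin k → Fin n), StrictMono ρ ∧ StrictMono τ ∧
    s = (∑ i, S (x (ρ i)) (y (τ i))) + δ * ((n : ℝ) - (k : ℝ))}

/-- The global score `L(Z) = L(X,Y)` of a pairwise sequence `z ∈ (𝔸×𝔸)ⁿ`. -/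
def scoreL {𝔸 : Type*} (S : 𝔸 → 𝔸 → ℝ) (δ : ℝ) (n : ℕ) (z : Fin n → 𝔸 × 𝔸) : ℝ :=
  alignScore S δ n (fun i => (z i).1) (fun i => (z i).2)

lemma aux_fact_upper (n : ℕ) (hn : 1 ≤ n) :
    (n.factorial : ℝ) ≤ Real.exp 1 * Real.sqrt n * ((n : ℝ) / Real.exp 1) ^ n := by
  have h := Stirling.stirlingSeq'_antitone (Nat.zero_le (n - 1))
  simp only [Function.comp] at h
  rw [show (n - 1).succ = n by omega, show Nat.succ 0 = 1 from rfl, Stirling.stirlingSeq_one,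
    Stirling.stirlingSeq] at h
  have hn' : (0 : ℝ) < n := by exact_mod_cast hn
  have he := Real.exp_pos 1
  have hpow : 0 < ((n : ℝ) / Real.exp 1) ^ n := by positivity
  have hs : 0 < Real.sqrt (2 * (n : ℝ)) := by positivity
  rw [div_le_iff₀ (by positivity)] at h
  refine h.trans (le_of_eq ?_)
  rw [Real.sqrt_mul (by norm_num)]
  have : Real.sqrt 2 ≠ 0 := by positivity
  field_simp

lemma aux_pow_lower (q : ℝ) (hq : 0 < q) (v u : ℝ) (hv : 0 < v) (hu : 0 < u) :
    u - u ^ 2 / (q * v) ≤ u * Real.log (q * v / u) := by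
  have h := Real.one_sub_inv_le_log_of_pos (show 0 < q * v / u by positivity)
  have h2 := mul_le_mul_of_nonneg_left h hu.le
  refine le_trans (le_of_eq ?_) h2
  field_simp

lemma aux_binom_lower (q : ℝ) (hq0 : 0 < q) (hq1 : q < 1) (v u : ℕ) (hu : 1 ≤ u) (huv : u < v)
    (hw : |(u : ℝ) - q * v| ≤ Real.sqrt v / 2) :
    1 / ((Real.sqrt (2 * Real.pi * q * (1 - q)) * Real.exp (1 / (2 * q * (1 - q)))) * Real.sqrt v)
      ≤ (v.choose u : ℝ) * q ^ u * (1 - q) ^ (v - u) := by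
  obtain ⟨w, rfl⟩ : ∃ w, v = u + w := ⟨v - u, by omega⟩
  have hw1 : 1 ≤ w := by omega
  have hu0 : (0 : ℝ) < u := by exact_mod_cast hu
  have hw0 : (0 : ℝ) < w := by exact_mod_cast hw1
  have hr0 : 0 < 1 - q := by linarith
  rw [Nat.add_sub_cancel_left]
  set V : ℝ := ((u + w : ℕ) : ℝ) with hV
  have hVe : V = u + w := by rw [hV]; push_cast; ring
  have hV0 : 0 < V := by rw [hVe]; positivity
  have he := Real.exp_pos 1
  have f1 := aux_fact_upper u hu
  have f2 := aux_fact_upper w hw1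
  have f3 := Stirling.le_factorial_stirling (u + w)
  rw [← hV] at f3
  have hch : ((u + w).choose u : ℝ) * (u.factorial * w.factorial) = (u + w).factorial := by
    have := Nat.add_choose_mul_factorial_mul_factorial u w
    rw [← Nat.choose_symm_add] at this
    rw [← mul_assoc]; exact_mod_cast this
  -- exponent estimate
  have hexp : Real.exp (-(1 / (4 * (q * (1 - q))))) ≤ (q * V / u) ^ u * ((1 - q) * V / w) ^ w := by
    have e1 : (q * V / u) ^ u = Real.exp (u * Real.log (q * V / u)) := by
      rw [mul_comm (u : ℝ), Real.exp_mul, Real.exp_log (by positivity), Real.rpow_natCast]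
    have e2 : ((1 - q) * V / w) ^ w = Real.exp (w * Real.log ((1 - q) * V / w)) := by
      rw [mul_comm (w : ℝ), Real.exp_mul, Real.exp_log (by positivity), Real.rpow_natCast]
    rw [e1, e2, ← Real.exp_add]
    apply Real.exp_le_exp.mpr
    have g1 := aux_pow_lower q hq0 V u hV0 hu0
    have g2 := aux_pow_lower (1 - q) hr0 V w hV0 hw0
    refine le_trans ?_ (add_le_add g1 g2)
    have hsq : ((u : ℝ) - q * V) ^ 2 ≤ V / 4 := by
      have := sq_le_sq' (by linarith [neg_abs_le ((u : ℝ) - q * V)]) ((le_abs_self _).trans hw)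
      rw [div_pow, Real.sq_sqrt hV0.le] at this
      linarith
    have : (u : ℝ) - u ^ 2 / (q * V) + (w - w ^ 2 / ((1 - q) * V))
        = -(((u : ℝ) - q * V) ^ 2 / (q * (1 - q) * V)) := by
      have hwe : (w : ℝ) = V - u := by linarith
      rw [hwe]; field_simp; ring
    rw [this, neg_le_neg_iff, div_le_iff₀ (by positivity)]
    refine hsq.trans (le_of_eq ?_)
    field_simp
  -- Stirling
  have hst : Real.sqrt (2 * Real.pi * V) / (Real.exp 1 ^ 2 * Real.sqrt u * Real.sqrt w)
      * ((q * V / u) ^ u * ((1 - q) * V / w) ^ w)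
      ≤ ((u + w).choose u : ℝ) * q ^ u * (1 - q) ^ w := by
    have hfac : (0 : ℝ) < u.factorial * w.factorial := by positivity
    have hprod : ((u.factorial : ℝ) * w.factorial) ≤
        (Real.exp 1 * Real.sqrt u * ((u : ℝ) / Real.exp 1) ^ u) *
        (Real.exp 1 * Real.sqrt w * ((w : ℝ) / Real.exp 1) ^ w) :=
      mul_le_mul f1 f2 (by positivity) (by positivity)
    have hc0 : (0 : ℝ) ≤ ((u + w).choose u : ℝ) := by positivity
    have h1 : Real.sqrt (2 * Real.pi * V) * (V / Real.exp 1) ^ (u + w) ≤ ((u + w).choose u : ℝ) *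
        ((Real.exp 1 * Real.sqrt u * ((u : ℝ) / Real.exp 1) ^ u) *
        (Real.exp 1 * Real.sqrt w * ((w : ℝ) / Real.exp 1) ^ w)) := by
      refine f3.trans ?_
      rw [← hch]
      exact mul_le_mul_of_nonneg_left hprod hc0
    have hsu : 0 < Real.sqrt u := by positivity
    have hsw : 0 < Real.sqrt w := by positivity
    have hqq : 0 ≤ q ^ u * (1 - q) ^ w := by positivity
    have h2 := mul_le_mul_of_nonneg_right h1 hqq
    have hK : 0 < (Real.exp 1 * Real.sqrt u * ((u : ℝ) / Real.exp 1) ^ u) *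
        (Real.exp 1 * Real.sqrt w * ((w : ℝ) / Real.exp 1) ^ w) := by positivity
    refine le_of_mul_le_mul_right ?_ hK
    refine le_trans (le_of_eq ?_) (h2.trans (le_of_eq ?_))
    · rw [div_pow, div_pow, div_pow, div_pow, div_pow, mul_pow, mul_pow, pow_add, pow_add]
      field_simp
    · ring
  refine le_trans ?_ (le_trans (mul_le_mul_of_nonneg_left hexp (by positivity)) hst)
  -- sqrt bound
  have huw : Real.sqrt u * Real.sqrt w ≤ V / 2 := by
    have := sq_nonneg (Real.sqrt u - Real.sqrt w)
    have a1 := Real.sq_sqrt hu0.le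
    have a2 := Real.sq_sqrt hw0.le
    nlinarith
  set s : ℝ := Real.sqrt (q * (1 - q)) with hs
  have hs0 : 0 < s := by rw [hs]; positivity
  have hs2 : s ^ 2 = q * (1 - q) := Real.sq_sqrt (by positivity)
  have hsle : s ≤ 1 / 2 := by
    nlinarith [sq_nonneg (q - 1 / 2)]
  have r1 : Real.sqrt (2 * Real.pi * q * (1 - q)) = Real.sqrt (2 * Real.pi) * s := by
    rw [hs, ← Real.sqrt_mul (by positivity)]; congr 1; ring
  have r2 : Real.sqrt (2 * Real.pi * V) = Real.sqrt (2 * Real.pi) * Real.sqrt V :=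
    Real.sqrt_mul (by positivity) _
  have r3 : Real.exp (1 / (2 * q * (1 - q))) =
      Real.exp (1 / (4 * (q * (1 - q)))) * Real.exp (1 / (4 * (q * (1 - q)))) := by
    rw [← Real.exp_add]; congr 1; field_simp; ring
  have hE : Real.exp 1 ≤ s * Real.exp (1 / (4 * (q * (1 - q)))) * 2 := by
    rw [← hs2]
    have h1 : 1 / (4 * s ^ 2) = 1 + (1 / (4 * s ^ 2) - 1) := by ring
    rw [h1, Real.exp_add]
    have h2 := Real.add_one_le_exp (1 / (4 * s ^ 2) - 1)
    have h3 : 1 ≤ s * (1 / (4 * s ^ 2)) * 2 := by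
      have : s * (1 / (4 * s ^ 2)) * 2 = 1 / (2 * s) := by field_simp; ring
      rw [this, le_div_iff₀ (by positivity)]; linarith
    have h4 : 1 ≤ s * Real.exp (1 / (4 * s ^ 2) - 1) * 2 := by
      refine h3.trans ?_
      have : 1 / (4 * s ^ 2) ≤ Real.exp (1 / (4 * s ^ 2) - 1) := by linarith
      gcongr
    nlinarith
  set E := Real.exp (1 / (4 * (q * (1 - q)))) with hEdef
  have hE0 : 0 < E := Real.exp_pos _
  rw [Real.exp_neg, ← hEdef, r1, r2, r3]
  have hsV : 0 < Real.sqrt V := by positivity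
  have hVV : Real.sqrt V * Real.sqrt V = V := Real.mul_self_sqrt hV0.le
  have hpi : Real.sqrt (2 * Real.pi) * Real.sqrt (2 * Real.pi) = 2 * Real.pi :=
    Real.mul_self_sqrt (by positivity)
  have hp0 : 0 < Real.sqrt (2 * Real.pi) := by positivity
  have hsu : 0 < Real.sqrt u := by positivity
  have hsw : 0 < Real.sqrt w := by positivity
  rw [← div_eq_mul_inv, div_div, div_le_div_iff₀ (by positivity) (by positivity)]
  have k1 : Real.sqrt (2 * Real.pi) * Real.sqrt V *
      (Real.sqrt (2 * Real.pi) * s * (E * E) * Real.sqrt V) = 2 * Real.pi * V * s * E * E := by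
    calc _ = (Real.sqrt (2 * Real.pi) * Real.sqrt (2 * Real.pi)) * (Real.sqrt V * Real.sqrt V)
          * s * E * E := by ring
      _ = _ := by rw [hpi, hVV]
  rw [k1, one_mul]
  have hpi3 := Real.pi_gt_three
  have he3 := Real.exp_one_lt_three
  calc Real.exp 1 ^ 2 * Real.sqrt u * Real.sqrt w * E
      = Real.exp 1 * Real.exp 1 * (Real.sqrt u * Real.sqrt w) * E := by ring
    _ ≤ 3 * (s * E * 2) * (V / 2) * E := by gcongr
    _ = 3 * V * s * E * E := by ring
    _ ≤ 2 * Real.pi * V * s * E * E := by gcongr; linarith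

lemma aux_align_bdd {𝔸 : Type*} (S : 𝔸 → 𝔸 → ℝ) (δ : ℝ) (n : ℕ) (x y : Fin n → 𝔸) (K : ℝ)
    (hK : ∀ a b, S a b ≤ K) (hK0 : 0 ≤ K) :
    BddAbove {s : ℝ | ∃ (k : ℕ) (ρ τ : Fin k → Fin n), StrictMono ρ ∧ StrictMono τ ∧
    s = (∑ i, S (x (ρ i)) (y (τ i))) + δ * ((n : ℝ) - (k : ℝ))} := by
  refine ⟨n * K + |δ| * n, ?_⟩
  rintro s ⟨k, ρ, τ, hρ, hτ, rfl⟩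
  have hk : k ≤ n := by
    have := Fintype.card_le_of_injective ρ hρ.injective
    simpa using this
  have hk' : (k : ℝ) ≤ n := by exact_mod_cast hk
  have h1 : (∑ i, S (x (ρ i)) (y (τ i))) ≤ k * K := by
    have := Finset.sum_le_card_nsmul (univ : Finset (Fin k)) (fun i => S (x (ρ i)) (y (τ i))) K
      (fun i _ => hK _ _)
    simpa using this
  have h2 : δ * ((n : ℝ) - k) ≤ |δ| * n := by
    have : (0 : ℝ) ≤ k := by positivity
    calc δ * ((n : ℝ) - k) ≤ |δ| * ((n : ℝ) - k) :=
          mul_le_mul_of_nonneg_right (le_abs_self _) (by linarith)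
      _ ≤ |δ| * n := mul_le_mul_of_nonneg_left (by linarith) (abs_nonneg _)
  have h3 : (k : ℝ) * K ≤ n * K := mul_le_mul_of_nonneg_right hk' hK0
  linarith

lemma aux_indicator_le {k n : ℕ} (ρ : Fin k → Fin n) (hρ : StrictMono ρ) (j : Fin n) :
    (∑ i, if ρ i = j then (1 : ℝ) else 0) ≤ 1 := by
  rw [Finset.sum_ite, Finset.sum_const_zero, add_zero, Finset.sum_const, nsmul_eq_mul, mul_one]
  have : (univ.filter fun i => ρ i = j).card ≤ 1 := by
    apply Finset.card_le_one.mpr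
    intro a ha b hb
    simp only [Finset.mem_filter, Finset.mem_univ, true_and] at ha hb
    exact hρ.injective (ha.trans hb.symm)
  exact_mod_cast this

lemma aux_score_lip {𝔸 : Type*} (S : 𝔸 → 𝔸 → ℝ) (δ : ℝ) (n : ℕ) (K : ℝ)
    (hK : ∀ a b, S a b ≤ K) (hS : ∀ a b, 0 ≤ S a b) (hK0 : 0 ≤ K) (z : Fin n → 𝔸 × 𝔸) (j : Fin n)
    (D : 𝔸 × 𝔸) :
    scoreL S δ n z - 2 * K ≤ scoreL S δ n (Function.update z j D) := by
  classical
  set z' := Function.update z j D with hz'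
  have hne : ∀ i, i ≠ j → z' i = z i := fun i hi => by rw [hz', Function.update_of_ne hi]
  unfold scoreL alignScore
  rw [sub_le_iff_le_add]
  apply csSup_le
  · refine ⟨_, 0, Fin.elim0, Fin.elim0, fun i => i.elim0, fun i => i.elim0, rfl⟩
  rintro s ⟨k, ρ, τ, hρ, hτ, rfl⟩
  have hle : (∑ i, S (z' (ρ i)).1 (z' (τ i)).2) + δ * ((n : ℝ) - (k : ℝ)) ≤ _ :=
    le_csSup (aux_align_bdd S δ n (fun i => (z' i).1) (fun i => (z' i).2) K hK hK0)
      ⟨k, ρ, τ, hρ, hτ, rfl⟩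
  have key : (∑ i, S (z (ρ i)).1 (z (τ i)).2) ≤ (∑ i, S (z' (ρ i)).1 (z' (τ i)).2) +
      (K * (∑ i, if ρ i = j then (1 : ℝ) else 0) + K * (∑ i, if τ i = j then (1 : ℝ) else 0)) := by
    rw [Finset.mul_sum, Finset.mul_sum, ← Finset.sum_add_distrib, ← Finset.sum_add_distrib]
    apply Finset.sum_le_sum
    intro i _
    have a1 := hK (z (ρ i)).1 (z (τ i)).2
    have a2 := hS (z' (ρ i)).1 (z' (τ i)).2
    by_cases h1 : ρ i = j
    · have : 0 ≤ K * (if τ i = j then (1 : ℝ) else 0) := by split_ifs <;> simp [hK0]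
      rw [if_pos h1]; linarith
    · by_cases h2 : τ i = j
      · rw [if_neg h1, if_pos h2]; linarith
      · rw [hne _ h1, hne _ h2, if_neg h1, if_neg h2]; linarith
  have b1 := mul_le_mul_of_nonneg_left (aux_indicator_le ρ hρ j) hK0
  have b2 := mul_le_mul_of_nonneg_left (aux_indicator_le τ hτ j) hK0
  linarith

open Classical in
/-- indices of the `(A·B)`-triplets -/
def setT {S : Type*} (A B : S) (n : ℕ) (z : Fin n → S) : Finset (Fin (n / 3)) :=
  univ.filter fun i => z (posA n i) = A ∧ z (posB n i) = B

open Classical in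
/-- indices of the `(A·B)`-triplets with middle letter `D` -/
def setH {S : Type*} (A B D : S) (n : ℕ) (z : Fin n → S) : Finset (Fin (n / 3)) :=
  univ.filter fun i => z (posA n i) = A ∧ z (posB n i) = B ∧ z (posM n i) = D

open Classical in
/-- indices of the `(A·B)`-triplets with middle letter not `D` -/
def setJ {S : Type*} (A B D : S) (n : ℕ) (z : Fin n → S) : Finset (Fin (n / 3)) :=
  univ.filter fun i => z (posA n i) = A ∧ z (posB n i) = B ∧ z (posM n i) ≠ D

lemma aux_card_add {S : Type*} (A B D : S) (n : ℕ) (z : Fin n → S) :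
    (setH A B D n z).card + (setJ A B D n z).card = (setT A B n z).card := by
  classical
  rw [← Finset.card_union_of_disjoint]
  · congr 1
    ext i
    simp only [setH, setJ, setT, Finset.mem_union, Finset.mem_filter, Finset.mem_univ, true_and]
    tauto
  · rw [Finset.disjoint_left]
    intro i
    simp only [setH, setJ, Finset.mem_filter, Finset.mem_univ, true_and]
    tauto

lemma posA_ne_posM (n : ℕ) (i j : Fin (n / 3)) : posA n i ≠ posM n j := by
  intro h
  have := congrArg Fin.val h
  simp only [posA, posM] at this
  omega

lemma posB_ne_posM (n : ℕ) (i j : Fin (n / 3)) : posB n i ≠ posM n j := by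
  intro h
  have := congrArg Fin.val h
  simp only [posB, posM] at this
  omega

lemma posM_ne_posM (n : ℕ) (i j : Fin (n / 3)) (hij : i ≠ j) : posM n i ≠ posM n j := by
  intro h
  have := congrArg Fin.val h
  simp only [posM] at this
  exact hij (Fin.ext (by omega))

lemma setT_update {S : Type*} (A B : S) (n : ℕ) (z : Fin n → S) (i : Fin (n / 3)) (C : S) :
    setT A B n (Function.update z (posM n i) C) = setT A B n z := by
  classical
  ext j
  simp only [setT, Finset.mem_filter, Finset.mem_univ, true_and,
    Function.update_of_ne (posA_ne_posM n j i), Function.update_of_ne (posB_ne_posM n j i)]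

lemma setH_update_ne {S : Type*} (A B D : S) (n : ℕ) (z : Fin n → S) (i : Fin (n / 3)) (C : S)
    (hC : C ≠ D) :
    setH A B D n (Function.update z (posM n i) C) = (setH A B D n z).erase i := by
  classical
  ext j
  simp only [setH, Finset.mem_filter, Finset.mem_univ, true_and, Finset.mem_erase,
    Function.update_of_ne (posA_ne_posM n j i), Function.update_of_ne (posB_ne_posM n j i)]
  by_cases h : j = i
  · subst h; simp [hC]
  · rw [Function.update_of_ne (posM_ne_posM n j i h)]; tauto

lemma setH_update_eq {S : Type*} (A B D : S) (n : ℕ) (z : Fin n → S) (i : Fin (n / 3))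
    (hi : i ∈ setJ A B D n z) :
    setH A B D n (Function.update z (posM n i) D) = insert i (setH A B D n z) := by
  classical
  simp only [setJ, Finset.mem_filter, Finset.mem_univ, true_and] at hi
  ext j
  simp only [setH, Finset.mem_filter, Finset.mem_univ, true_and, Finset.mem_insert,
    Function.update_of_ne (posA_ne_posM n j i), Function.update_of_ne (posB_ne_posM n j i)]
  by_cases h : j = i
  · subst h; simp [hi]
  · rw [Function.update_of_ne (posM_ne_posM n j i h)]; tauto

lemma aux_kernel_sum {S : Type*} [Fintype S] (A B D : S) (n : ℕ) (z : Fin n → S)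
    (f : (Fin n → S) → ℝ) (hJ : (setJ A B D n z).Nonempty) :
    ∑ z', kernelR A B D n z z' * f z' =
      (∑ i ∈ setJ A B D n z, f (Function.update z (posM n i) D)) / (setJ A B D n z).card := by
  classical
  have h1 : ∀ z', kernelR A B D n z z' * f z' =
      (∑ i ∈ setJ A B D n z, if Function.update z (posM n i) D = z' then f z' else 0)
        / (setJ A B D n z).card := by
    intro z'
    have : kernelR A B D n z z' = (((setJ A B D n z).filter
      fun i => Function.update z (posM n i) D = z').card : ℝ) / (setJ A B D n z).card := by
      unfold kernelR
      simp only [setJ] at hJ ⊢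
      rw [if_pos hJ]
    rw [this, ← Finset.sum_filter, Finset.sum_const, nsmul_eq_mul, div_mul_eq_mul_div]
  simp_rw [h1]
  rw [← Finset.sum_div, Finset.sum_comm]
  congr 1
  apply Finset.sum_congr rfl
  intro i _
  simp

lemma aux_kernel_sum_empty {S : Type*} [Fintype S] (A B D : S) (n : ℕ) (z : Fin n → S)
    (f : (Fin n → S) → ℝ) (hJ : ¬ (setJ A B D n z).Nonempty) :
    ∑ z', kernelR A B D n z z' * f z' = f z := by
  classical
  have : ∀ z', kernelR A B D n z z' = if z' = z then 1 else 0 := by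
    intro z'
    unfold kernelR
    simp only [setJ] at hJ ⊢
    rw [if_neg hJ]
  simp [this]

lemma aux_chainLaw_update {S : Type*} (π : S → ℝ) (p : S → S → ℝ) (A B D : S) (n : ℕ)
    (z : Fin n → S) (i : Fin (n / 3)) (C : S) (hA : z (posA n i) = A) (hB : z (posB n i) = B)
    (hD : z (posM n i) = D) :
    chainLaw π p n (Function.update z (posM n i) C) * (p A D * p D B)
      = chainLaw π p n z * (p A C * p C B) := by
  classical
  have hi := i.isLt
  have hn : 0 < n := by omega
  unfold chainLaw
  rw [dif_pos hn, dif_pos hn]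
  have h0 : Function.update z (posM n i) C ⟨0, hn⟩ = z ⟨0, hn⟩ := by
    apply Function.update_of_ne
    intro h
    have := congrArg Fin.val h
    simp [posM] at this
  rw [h0]
  let a : Fin (n - 1) := ⟨3 * i.1, by omega⟩
  let b : Fin (n - 1) := ⟨3 * i.1 + 1, by omega⟩
  have hab : b ≠ a := by
    intro h
    have := congrArg Fin.val h
    simp [a, b] at this
  have split : ∀ F : Fin (n - 1) → ℝ, ∏ j, F j = F a * (F b * ∏ j ∈ (univ.erase a).erase b, F j) := by
    intro F
    rw [Finset.mul_prod_erase _ _ (Finset.mem_erase.mpr ⟨hab, Finset.mem_univ _⟩),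
      Finset.mul_prod_erase _ _ (Finset.mem_univ _)]
  rw [split, split]
  have hrest : ∀ j ∈ ((univ : Finset (Fin (n - 1))).erase a).erase b,
      p (Function.update z (posM n i) C ⟨j.1, by have := j.isLt; omega⟩)
        (Function.update z (posM n i) C ⟨j.1 + 1, by have := j.isLt; omega⟩)
      = p (z ⟨j.1, by have := j.isLt; omega⟩) (z ⟨j.1 + 1, by have := j.isLt; omega⟩) := by
    intro j hj
    simp only [Finset.mem_erase, Finset.mem_univ, and_true] at hj
    have hj1 : j.1 ≠ 3 * i.1 + 1 := fun h => hj.1 (Fin.ext h)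
    have hj2 : j.1 ≠ 3 * i.1 := fun h => hj.2 (Fin.ext h)
    rw [Function.update_of_ne, Function.update_of_ne]
    · intro h; have := congrArg Fin.val h; simp only [posM] at this; omega
    · intro h; have := congrArg Fin.val h; simp only [posM] at this; omega
  rw [Finset.prod_congr rfl hrest]
  have ea1 : Function.update z (posM n i) C ⟨a.1, by have := a.isLt; omega⟩ = A := by
    rw [← hA]; exact Function.update_of_ne (posA_ne_posM n i i) _ _
  have ea2 : Function.update z (posM n i) C ⟨a.1 + 1, by have := a.isLt; omega⟩ = C :=
    Function.update_self (posM n i) C z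
  have eb1 : Function.update z (posM n i) C ⟨b.1, by have := b.isLt; omega⟩ = C :=
    Function.update_self (posM n i) C z
  have eb2 : Function.update z (posM n i) C ⟨b.1 + 1, by have := b.isLt; omega⟩ = B := by
    rw [← hB]; exact Function.update_of_ne (posB_ne_posM n i i) _ _
  have fa1 : z ⟨a.1, by have := a.isLt; omega⟩ = A := hA
  have fa2 : z ⟨a.1 + 1, by have := a.isLt; omega⟩ = D := hD
  have fb1 : z ⟨b.1, by have := b.isLt; omega⟩ = D := hD
  have fb2 : z ⟨b.1 + 1, by have := b.isLt; omega⟩ = B := hB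
  rw [ea1, ea2, eb2, fa1, fa2, fb2]
  ring

open Classical in
/-- the class `U = u`, `V = v` -/
def cls {S : Type*} [Fintype S] (A B D : S) (n u v : ℕ) : Finset (Fin n → S) :=
  univ.filter fun z => (setH A B D n z).card = u ∧ (setT A B n z).card = v

lemma aux_transfer {S : Type*} [Fintype S] (π : S → ℝ) (p : S → S → ℝ) (A B D : S)
    (R q : ℝ) (hR : R = ∑ C, p A C * p C B) (hR0 : 0 < R) (hq : q = p A D * p D B / R)
    (hq0 : 0 < q)
    (n u v : ℕ) (huv : u < v) (f : (Fin n → S) → ℝ) :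
    ∑ z ∈ cls A B D n u v, chainLaw π p n z * (∑ z', kernelR A B D n z z' * f z') =
      (((u : ℝ) + 1) * (1 - q) / (((v : ℝ) - u) * q)) *
        ∑ z' ∈ cls A B D n (u + 1) v, chainLaw π p n z' * f z' := by
  classical
  have hvu : (0 : ℝ) < (v : ℝ) - u := by
    have : (u : ℝ) < v := by exact_mod_cast huv
    linarith
  have hpD : p A D * p D B = q * R := by rw [hq]; field_simp
  have hcardJ : ∀ z ∈ cls A B D n u v, ((setJ A B D n z).card : ℝ) = v - u := by
    intro z hz
    simp only [cls, Finset.mem_filter, Finset.mem_univ, true_and] at hz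
    have := aux_card_add A B D n z
    rw [hz.1, hz.2] at this
    rw [← this]; push_cast; ring
  have hL : ∑ z ∈ cls A B D n u v, chainLaw π p n z * (∑ z', kernelR A B D n z z' * f z')
      = (∑ i : Fin (n / 3), ∑ z ∈ (cls A B D n u v).filter (fun z => i ∈ setJ A B D n z),
          chainLaw π p n z * f (Function.update z (posM n i) D)) / ((v : ℝ) - u) := by
    have : ∀ z ∈ cls A B D n u v,
        chainLaw π p n z * (∑ z', kernelR A B D n z z' * f z') =
        (∑ i : Fin (n / 3), if i ∈ setJ A B D n z then
          chainLaw π p n z * f (Function.update z (posM n i) D) else 0) / ((v : ℝ) - u) := by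
      intro z hz
      have hc := hcardJ z hz
      have hne : (setJ A B D n z).Nonempty := by
        rw [← Finset.card_pos]
        have : (0 : ℝ) < (setJ A B D n z).card := by rw [hc]; exact hvu
        exact_mod_cast this
      rw [aux_kernel_sum A B D n z f hne, hc, ← Finset.sum_filter, Finset.filter_mem_eq_inter,
        Finset.univ_inter, mul_div_assoc', Finset.mul_sum]
    rw [Finset.sum_congr rfl this, ← Finset.sum_div, Finset.sum_comm]
    congr 1
    apply Finset.sum_congr rfl
    intro i _
    rw [Finset.sum_filter]
  have hRs : ((u : ℝ) + 1) * ∑ z' ∈ cls A B D n (u + 1) v, chainLaw π p n z' * f z'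
      = ∑ i : Fin (n / 3), ∑ z ∈ (cls A B D n (u + 1) v).filter (fun z => i ∈ setH A B D n z),
          chainLaw π p n z * f z := by
    rw [Finset.mul_sum]
    have : ∀ z ∈ cls A B D n (u + 1) v, ((u : ℝ) + 1) * (chainLaw π p n z * f z) =
        ∑ i : Fin (n / 3), if i ∈ setH A B D n z then chainLaw π p n z * f z else 0 := by
      intro z hz
      simp only [cls, Finset.mem_filter, Finset.mem_univ, true_and] at hz
      rw [← Finset.sum_filter, Finset.filter_mem_eq_inter,
        Finset.univ_inter, Finset.sum_const, hz.1, nsmul_eq_mul]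
      push_cast; ring
    rw [Finset.sum_congr rfl this, Finset.sum_comm]
    apply Finset.sum_congr rfl
    intro i _
    rw [Finset.sum_filter]
  have hsumC : ∑ C ∈ univ.filter (fun C => C ≠ D), p A C * p C B = (1 - q) * R := by
    have := Finset.sum_filter_add_sum_filter_not (univ : Finset S) (fun C => C ≠ D)
      (fun C => p A C * p C B)
    have h2 : (univ.filter fun C : S => ¬ C ≠ D) = {D} := by ext; simp
    rw [h2, Finset.sum_singleton, ← hR, hpD] at this
    linarith
  have hmain : ∀ i : Fin (n / 3),
      ∑ z ∈ (cls A B D n u v).filter (fun z => i ∈ setJ A B D n z),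
          chainLaw π p n z * f (Function.update z (posM n i) D) =
      ((1 - q) / q) * ∑ z ∈ (cls A B D n (u + 1) v).filter (fun z => i ∈ setH A B D n z),
          chainLaw π p n z * f z := by
    intro i
    have e1 : ((1 - q) / q) * ∑ z ∈ (cls A B D n (u + 1) v).filter (fun z => i ∈ setH A B D n z),
          chainLaw π p n z * f z =
        ∑ x ∈ ((cls A B D n (u + 1) v).filter (fun z => i ∈ setH A B D n z)) ×ˢ
          (univ.filter (fun C => C ≠ D)),
          chainLaw π p n (Function.update x.1 (posM n i) x.2) * f x.1 := by
      rw [Finset.sum_product, Finset.mul_sum]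
      apply Finset.sum_congr rfl
      intro z hz
      simp only [Finset.mem_filter, setH, Finset.mem_univ, true_and] at hz
      obtain ⟨_, hA, hB, hD⟩ := hz
      have : ∀ C ∈ univ.filter (fun C => C ≠ D),
          chainLaw π p n (Function.update z (posM n i) C) * f z =
          (p A C * p C B) * (chainLaw π p n z * f z / (q * R)) := by
        intro C _
        have := aux_chainLaw_update π p A B D n z i C hA hB hD
        rw [hpD] at this
        have h3 : chainLaw π p n (Function.update z (posM n i) C) =
          chainLaw π p n z * (p A C * p C B) / (q * R) := by
          rw [eq_div_iff (by positivity)]; exact this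
        rw [h3]; ring
      rw [Finset.sum_congr rfl this, ← Finset.sum_mul, hsumC]
      field_simp
    rw [e1]
    symm
    refine Finset.sum_nbij' (fun x => Function.update x.1 (posM n i) x.2)
      (fun z => (Function.update z (posM n i) D, z (posM n i))) ?_ ?_ ?_ ?_ ?_
    · rintro ⟨z, C⟩ hx
      simp only [Finset.mem_product, Finset.mem_filter, Finset.mem_univ, true_and, cls] at hx ⊢
      obtain ⟨⟨⟨hu, hv⟩, hi⟩, hC⟩ := hx
      refine ⟨⟨?_, ?_⟩, ?_⟩
      · rw [setH_update_ne A B D n z i C hC, Finset.card_erase_of_mem hi, hu]; rfl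
      · rw [setT_update, hv]
      · simp only [setH, setJ, Finset.mem_filter, Finset.mem_univ, true_and] at hi ⊢
        rw [Function.update_of_ne (posA_ne_posM n i i), Function.update_of_ne (posB_ne_posM n i i),
          Function.update_self]
        exact ⟨hi.1, hi.2.1, hC⟩
    · intro z hz
      simp only [Finset.mem_product, Finset.mem_filter, Finset.mem_univ, true_and, cls] at hz ⊢
      obtain ⟨⟨hu, hv⟩, hi⟩ := hz
      have hi' := hi
      simp only [setJ, Finset.mem_filter, Finset.mem_univ, true_and] at hi'
      have hni : i ∉ setH A B D n z := by
        simp only [setH, Finset.mem_filter, Finset.mem_univ, true_and]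
        tauto
      refine ⟨⟨⟨?_, ?_⟩, ?_⟩, hi'.2.2⟩
      · rw [setH_update_eq A B D n z i hi, Finset.card_insert_of_notMem hni, hu]
      · rw [setT_update, hv]
      · rw [setH_update_eq A B D n z i hi]; exact Finset.mem_insert_self _ _
    · rintro ⟨z, C⟩ hx
      simp only [Finset.mem_product, Finset.mem_filter, Finset.mem_univ, true_and, setH] at hx
      simp only [Function.update_idem, Function.update_self, Prod.mk.injEq, and_true]
      rw [← hx.1.2.2.2, Function.update_eq_self]
    · intro z _
      simp
    · rintro ⟨z, C⟩ hx
      simp only [Finset.mem_product, Finset.mem_filter, Finset.mem_univ, true_and, setH] at hx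
      simp only [Function.update_idem]
      rw [← hx.1.2.2.2, Function.update_eq_self]
  rw [hL, Finset.sum_congr rfl (fun i _ => hmain i), ← Finset.mul_sum, ← hRs]
  field_simp

/-- weight of a path `z` of a chain started (one step before) at `x` -/
def pathQ {S : Type*} (p : S → S → ℝ) : (n : ℕ) → S → (Fin n → S) → ℝ
  | 0, _, _ => 1
  | n + 1, x, z => p x (z 0) * pathQ p n (z 0) (Fin.tail z)

lemma chainLaw_succ {S : Type*} (π : S → ℝ) (p : S → S → ℝ) (n : ℕ) (z : Fin (n + 1) → S) :
    chainLaw π p (n + 1) z = π (z 0) * pathQ p n (z 0) (Fin.tail z) := by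
  have h : ∀ (n : ℕ) (z : Fin (n + 1) → S),
      ∏ i : Fin n, p (z i.castSucc) (z i.succ) = pathQ p n (z 0) (Fin.tail z) := by
    intro n
    induction n with
    | zero => intro z; simp [pathQ]
    | succ k ih =>
      intro z
      rw [Fin.prod_univ_succ, pathQ, ← ih]
      rfl
  rw [← h]
  unfold chainLaw
  rw [dif_pos (Nat.succ_pos n)]
  rfl

lemma sum_fin_cons {S : Type*} [Fintype S] (n : ℕ) (F : (Fin (n + 1) → S) → ℝ) :
    ∑ z, F z = ∑ a, ∑ z : Fin n → S, F (Fin.cons a z) := by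
  rw [← Fintype.sum_prod_type']
  exact (Fintype.sum_equiv (Fin.consEquiv (fun _ : Fin (n + 1) => S)) _ _ (fun _ => rfl)).symm

/-- expectation with respect to `pathQ` -/
def pathE {S : Type*} [Fintype S] (p : S → S → ℝ) (n : ℕ) (x : S) (F : (Fin n → S) → ℝ) : ℝ :=
  ∑ z, pathQ p n x z * F z

lemma pathE_succ {S : Type*} [Fintype S] (p : S → S → ℝ) (n : ℕ) (x : S)
    (F : (Fin (n + 1) → S) → ℝ) :
    pathE p (n + 1) x F = ∑ a, p x a * pathE p n a (fun z => F (Fin.cons a z)) := by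
  unfold pathE
  rw [sum_fin_cons]
  apply Finset.sum_congr rfl
  intro a _
  rw [Finset.mul_sum]
  apply Finset.sum_congr rfl
  intro z _
  simp only [pathQ, Fin.cons_zero, Fin.tail_cons]
  ring

lemma chain_eq_pathE {S : Type*} [Fintype S] (π : S → ℝ) (p : S → S → ℝ)
    (hstat : ∀ y, ∑ x, π x * p x y = π y) (hπ : ∑ x, π x = 1)
    (n : ℕ) (F : (Fin n → S) → ℝ) :
    ∑ z, chainLaw π p n z * F z = ∑ x, π x * pathE p n x F := by
  cases n with
  | zero =>
    simp [chainLaw, pathE, pathQ, ← Finset.sum_mul, hπ]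
  | succ n =>
    simp_rw [pathE_succ, Finset.mul_sum]
    rw [Finset.sum_comm, sum_fin_cons]
    apply Finset.sum_congr rfl
    intro a _
    have : ∀ x, π x * (p x a * pathE p n a fun z => F (Fin.cons a z)) =
      (π x * p x a) * pathE p n a fun z => F (Fin.cons a z) := fun x => by ring
    simp_rw [this]
    rw [← Finset.sum_mul, hstat, pathE, Finset.mul_sum]
    apply Finset.sum_congr rfl
    intro z _
    rw [chainLaw_succ]
    simp only [Fin.cons_zero, Fin.tail_cons]
    ring

lemma pathE_add {S : Type*} [Fintype S] (p : S → S → ℝ) (n : ℕ) (x : S) (F G : (Fin n → S) → ℝ) :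
    pathE p n x (fun z => F z + G z) = pathE p n x F + pathE p n x G := by
  simp [pathE, mul_add, Finset.sum_add_distrib]

lemma pathE_smul {S : Type*} [Fintype S] (p : S → S → ℝ) (n : ℕ) (x : S) (c : ℝ)
    (F : (Fin n → S) → ℝ) :
    pathE p n x (fun z => c * F z) = c * pathE p n x F := by
  simp only [pathE, Finset.mul_sum]
  apply Finset.sum_congr rfl
  intro z _
  ring

lemma pathE_const {S : Type*} [Fintype S] (p : S → S → ℝ) (hprow : ∀ x, ∑ y, p x y = 1) (n : ℕ)
    (x : S) (c : ℝ) : pathE p n x (fun _ => c) = c := by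
  induction n generalizing x with
  | zero => simp [pathE, pathQ]
  | succ n ih =>
    rw [pathE_succ]
    simp only [ih]
    rw [← Finset.sum_mul, hprow, one_mul]

/-- the three-step average -/
def step3 {S : Type*} [Fintype S] (p : S → S → ℝ) (x : S) (F : S → S → S → ℝ) : ℝ :=
  ∑ a, p x a * ∑ b, p a b * ∑ c, p b c * F a b c

lemma pathE_three {S : Type*} [Fintype S] (p : S → S → ℝ) (n : ℕ) (x : S)
    (F : (Fin (n + 3) → S) → ℝ) :
    pathE p (n + 3) x F = step3 p x (fun a b c => pathE p n c
      (fun z => F (Fin.cons a (Fin.cons b (Fin.cons c z : Fin (n + 1) → S) : Fin (n + 2) → S)))) := by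
  unfold step3
  rw [pathE_succ]
  simp_rw [pathE_succ]

lemma step3_add {S : Type*} [Fintype S] (p : S → S → ℝ) (x : S) (F G : S → S → S → ℝ) :
    step3 p x (fun a b c => F a b c + G a b c) = step3 p x F + step3 p x G := by
  simp [step3, mul_add, Finset.sum_add_distrib]

lemma step3_mono {S : Type*} [Fintype S] (p : S → S → ℝ) (hpnn : ∀ x y, 0 ≤ p x y) (x : S)
    (F G : S → S → S → ℝ)
    (h : ∀ a b c, F a b c ≤ G a b c) : step3 p x F ≤ step3 p x G := by
  unfold step3
  refine Finset.sum_le_sum fun a _ => mul_le_mul_of_nonneg_left ?_ (hpnn _ _)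
  refine Finset.sum_le_sum fun b _ => mul_le_mul_of_nonneg_left ?_ (hpnn _ _)
  refine Finset.sum_le_sum fun c _ => mul_le_mul_of_nonneg_left (h _ _ _) (hpnn _ _)

lemma step3_const {S : Type*} [Fintype S] (p : S → S → ℝ) (hprow : ∀ x, ∑ y, p x y = 1) (x : S)
    (k : ℝ) : step3 p x (fun _ _ _ => k) = k := by
  unfold step3
  simp_rw [← Finset.sum_mul, hprow, one_mul, ← Finset.sum_mul, hprow, one_mul]
  rw [← Finset.sum_mul, hprow, one_mul]

open Classical in
/-- indicator of a good triplet -/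
def ind3 {S : Type*} (A B : S) (a _b c : S) : ℝ := if a = A ∧ c = B then 1 else 0

lemma setT_cons {S : Type*} (A B : S) (n : ℕ) (a b c : S) (z : Fin n → S) :
    ((setT A B (n + 3) (Fin.cons a (Fin.cons b (Fin.cons c z : Fin (n + 1) → S) :
      Fin (n + 2) → S))).card : ℝ) = ind3 A B a b c + (setT A B n z).card := by
  classical
  have hdiv : (n + 3) / 3 = n / 3 + 1 := by omega
  unfold setT
  rw [Finset.card_filter, Finset.card_filter]
  push_cast
  rw [← Fintype.sum_equiv (finCongr hdiv.symm) _ _ (fun _ => rfl), Fin.sum_univ_succ]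
  congr 1

/-- centered count -/
def cenV {S : Type*} (A B : S) (r : ℝ) (n : ℕ) (z : Fin n → S) : ℝ :=
  (setT A B n z).card - r * (n / 3 : ℕ)

lemma cenV_cons {S : Type*} (A B : S) (r : ℝ) (n : ℕ) (a b c : S) (z : Fin n → S) :
    cenV A B r (n + 3) (Fin.cons a (Fin.cons b (Fin.cons c z : Fin (n + 1) → S) :
      Fin (n + 2) → S)) = (ind3 A B a b c - r) + cenV A B r n z := by
  unfold cenV
  rw [setT_cons, show (n + 3) / 3 = n / 3 + 1 by omega]
  push_cast
  ring

lemma cenV_small {S : Type*} (A B : S) (r : ℝ) (n : ℕ) (hn : n < 3) (z : Fin n → S) :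
    cenV A B r n z = 0 := by
  have h : n / 3 = 0 := by omega
  have : setT A B n z = ∅ := by
    apply Finset.eq_empty_of_forall_notMem
    intro i
    have := i.isLt
    omega
  unfold cenV
  rw [this, h]; simp

lemma aux_first_moment {S : Type*} [Fintype S] (p : S → S → ℝ) (hpnn : ∀ x y, 0 ≤ p x y)
    (hprow : ∀ x, ∑ y, p x y = 1) (A B : S) (r : ℝ) (h : S → ℝ) (H : ℝ) (hH : ∀ x, |h x| ≤ H)
    (hpois : ∀ x, h x = step3 p x (fun a b c => (ind3 A B a b c - r) + h c)) (n : ℕ) :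
    ∀ x, |pathE p n x (cenV A B r n) - h x| ≤ H := by
  induction n using Nat.strong_induction_on with
  | _ n ih =>
    intro x
    by_cases hn : n < 3
    · have : cenV A B r n = fun _ => 0 := funext (cenV_small A B r n hn)
      rw [this, pathE_const p hprow, zero_sub, abs_neg]
      exact hH x
    · obtain ⟨m, rfl⟩ : ∃ m, n = m + 3 := ⟨n - 3, by omega⟩
      have ihm := ih m (by omega)
      rw [pathE_three]
      simp_rw [cenV_cons, pathE_add, pathE_const p hprow]
      rw [hpois x]
      rw [abs_le]
      constructor
      · have := step3_mono p hpnn x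
          (fun a b c => ind3 A B a b c - r + h c + (-H))
          (fun a b c => ind3 A B a b c - r + pathE p m c (fun z => cenV A B r m z))
          (fun a b c => by have := (abs_le.mp (ihm c)).1; linarith)
        rw [step3_add, step3_const p hprow] at this
        linarith
      · have := step3_mono p hpnn x
          (fun a b c => ind3 A B a b c - r + pathE p m c (fun z => cenV A B r m z))
          (fun a b c => ind3 A B a b c - r + h c + H)
          (fun a b c => by have := (abs_le.mp (ihm c)).2; linarith)
        rw [step3_add p x _ (fun _ _ _ => H), step3_const p hprow] at this
        linarith

lemma aux_second_moment {S : Type*} [Fintype S] (p : S → S → ℝ) (hpnn : ∀ x y, 0 ≤ p x y)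
    (hprow : ∀ x, ∑ y, p x y = 1) (A B : S) (r : ℝ) (hr0 : 0 ≤ r) (hr1 : r ≤ 1)
    (K : ℝ) (hK : ∀ n x, |pathE p n x (cenV A B r n)| ≤ K) (n : ℕ) :
    ∀ x, pathE p n x (fun z => cenV A B r n z ^ 2) ≤ (1 + 2 * K) * n := by
  induction n using Nat.strong_induction_on with
  | _ n ih =>
    intro x
    have hK0 : 0 ≤ K := (abs_nonneg _).trans (hK 0 x)
    by_cases hn : n < 3
    · have : (fun z => cenV A B r n z ^ 2) = fun _ => 0 :=
        funext fun z => by rw [cenV_small A B r n hn]; norm_num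
      rw [this, pathE_const p hprow]
      positivity
    · obtain ⟨m, rfl⟩ : ∃ m, n = m + 3 := ⟨n - 3, by omega⟩
      have ihm := ih m (by omega)
      rw [pathE_three]
      have e : ∀ a b c (z : Fin m → S), cenV A B r (m + 3)
          (Fin.cons a (Fin.cons b (Fin.cons c z : Fin (m + 1) → S) : Fin (m + 2) → S)) ^ 2 =
          (ind3 A B a b c - r) ^ 2 + (2 * (ind3 A B a b c - r) * cenV A B r m z
            + cenV A B r m z ^ 2) := by
        intro a b c z
        rw [cenV_cons]; ring
      simp_rw [e, pathE_add, pathE_const p hprow, pathE_smul]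
      have := step3_mono p hpnn x
        (fun a b c => (ind3 A B a b c - r) ^ 2 + (2 * (ind3 A B a b c - r) *
          pathE p m c (fun z => cenV A B r m z) + pathE p m c (fun z => cenV A B r m z ^ 2)))
        (fun a b c => (1 + 2 * K) * m + (1 + 2 * K)) (by
          intro a b c
          have hd : |ind3 A B a b c - r| ≤ 1 := by
            unfold ind3
            split_ifs <;> rw [abs_le] <;> constructor <;> linarith
          have h1 : (ind3 A B a b c - r) ^ 2 ≤ 1 := by
            rw [← sq_abs]; exact pow_le_one₀ (abs_nonneg _) hd
          have h2 : (ind3 A B a b c - r) * pathE p m c (fun z => cenV A B r m z) ≤ 1 * K := by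
            refine (le_abs_self _).trans ?_
            rw [abs_mul]
            exact mul_le_mul hd (hK m c) (abs_nonneg _) zero_le_one
          have := ihm c
          linarith)
      rw [step3_const p hprow] at this
      refine this.trans ?_
      push_cast
      nlinarith

lemma aux_mat3 {S : Type*} [Fintype S] [DecidableEq S] (p : S → S → ℝ) (x : S) (h : S → ℝ) :
    step3 p x (fun _ _ c => h c) = (Matrix.mulVec (Matrix.of p ^ 3) h) x := by
  rw [pow_succ, pow_succ, pow_one, ← Matrix.mulVec_mulVec, ← Matrix.mulVec_mulVec]
  simp only [step3, Matrix.mulVec, dotProduct, Matrix.of_apply]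

lemma aux_poisson {S : Type*} [Fintype S] [DecidableEq S] [Nonempty S] (p : S → S → ℝ)
    (hprow : ∀ x, ∑ y, p x y = 1)
    (π : S → ℝ) (hπsum : ∑ x, π x = 1)
    (hstat : ∀ y, ∑ x, π x * p x y = π y)
    (haper : ∃ m : ℕ, ∀ x y, 0 < (Matrix.of p ^ m) x y)
    (g : S → ℝ) (hg : ∑ x, π x * g x = 0) :
    ∃ h : S → ℝ, ∀ x, h x = g x + step3 p x (fun _ _ c => h c) := by
  obtain ⟨m, hm⟩ := haper
  set M := Matrix.of p with hM
  have hone : ∀ k : ℕ, Matrix.mulVec (M ^ k) (fun _ => (1 : ℝ)) = fun _ => 1 := by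
    intro k
    induction k with
    | zero => simp
    | succ k ih =>
      rw [pow_succ, ← Matrix.mulVec_mulVec]
      have : Matrix.mulVec M (fun _ => (1 : ℝ)) = fun _ => 1 := by
        ext x; simp [Matrix.mulVec, dotProduct, hM, hprow]
      rw [this, ih]
  have hpi : ∀ k : ℕ, Matrix.vecMul π (M ^ k) = π := by
    intro k
    induction k with
    | zero => simp
    | succ k ih =>
      rw [pow_succ, ← Matrix.vecMul_vecMul, ih]
      ext y
      simp [Matrix.vecMul, dotProduct, hM, hstat]
  have hpos3 : ∀ x y, 0 < ((M ^ 3) ^ m) x y := by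
    intro x y
    rw [← pow_mul, mul_comm, pow_mul, pow_succ, pow_succ, pow_one]
    simp only [Matrix.mul_apply]
    refine Finset.sum_pos (fun a _ => mul_pos (Finset.sum_pos (fun b _ => mul_pos (hm _ _) (hm _ _))
      Finset.univ_nonempty) (hm _ _)) Finset.univ_nonempty
  let T : (S → ℝ) →ₗ[ℝ] (S → ℝ) := Matrix.mulVecLin (1 - M ^ 3)
  let ℓ : (S → ℝ) →ₗ[ℝ] ℝ := ∑ x, π x • LinearMap.proj x
  have hℓ : ∀ f, ℓ f = ∑ x, π x * f x := fun f => by simp [ℓ]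
  have hT : ∀ f, T f = f - Matrix.mulVec (M ^ 3) f := by
    intro f
    simp [T]
  have hker : LinearMap.ker T ≤ Submodule.span ℝ {fun _ => (1 : ℝ)} := by
    intro f hf
    rw [LinearMap.mem_ker, hT, sub_eq_zero] at hf
    have hfk : ∀ k : ℕ, Matrix.mulVec ((M ^ 3) ^ k) f = f := by
      intro k
      induction k with
      | zero => simp
      | succ k ih => rw [pow_succ, ← Matrix.mulVec_mulVec, ← hf, ih]
    obtain ⟨x0, hx0⟩ := Finite.exists_max f
    rw [Submodule.mem_span_singleton]
    refine ⟨f x0, ?_⟩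
    have e1 : ∑ y, ((M ^ 3) ^ m) x0 y * f y = f x0 := congrFun (hfk m) x0
    have e2 : ∑ y, ((M ^ 3) ^ m) x0 y * 1 = 1 := by
      have := congrFun (hone (3 * m)) x0
      rw [pow_mul] at this
      exact this
    have e3 : ∑ y, ((M ^ 3) ^ m) x0 y * (f x0 - f y) = 0 := by
      simp_rw [mul_sub, Finset.sum_sub_distrib, e1, ← Finset.sum_mul]
      simp only [mul_one] at e2
      rw [e2]; ring
    have e4 := (Finset.sum_eq_zero_iff_of_nonneg (fun y _ =>
      mul_nonneg (hpos3 x0 y).le (sub_nonneg.mpr (hx0 y)))).mp e3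
    ext y
    have := e4 y (Finset.mem_univ _)
    rcases mul_eq_zero.mp this with h | h
    · exact absurd h (hpos3 x0 y).ne'
    · simp; linarith
  have hrange : LinearMap.range T ≤ LinearMap.ker ℓ := by
    rintro _ ⟨f, rfl⟩
    rw [LinearMap.mem_ker, hT, map_sub]
    have : ℓ (Matrix.mulVec (M ^ 3) f) = ℓ f := by
      rw [hℓ, hℓ]
      have h1 : π ⬝ᵥ (Matrix.mulVec (M ^ 3) f) = π ⬝ᵥ f := by
        rw [Matrix.dotProduct_mulVec, hpi]
      exact h1
    rw [this, sub_self]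
  have hℓsurj : LinearMap.range ℓ = ⊤ := by
    rw [LinearMap.range_eq_top]
    intro c
    refine ⟨fun _ => c, ?_⟩
    rw [hℓ, ← Finset.sum_mul, hπsum, one_mul]
  have d1 := LinearMap.finrank_range_add_finrank_ker T
  have d2 := LinearMap.finrank_range_add_finrank_ker ℓ
  rw [hℓsurj, finrank_top, Module.finrank_self] at d2
  have d3 : Module.finrank ℝ (LinearMap.ker T) ≤ 1 :=
    (Submodule.finrank_mono hker).trans (finrank_span_singleton (fun h0 => one_ne_zero (congrFun h0 (Classical.arbitrary S)))).le
  have heq := Submodule.eq_of_le_of_finrank_le hrange (by omega)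
  have hgm : g ∈ LinearMap.range T := by
    rw [heq, LinearMap.mem_ker, hℓ, hg]
  obtain ⟨h, hh⟩ := hgm
  refine ⟨h, fun x => ?_⟩
  rw [aux_mat3]
  rw [hT] at hh
  have := congrFun hh x
  simp only [Pi.sub_apply] at this
  linarith

lemma aux_lln {S : Type*} [Fintype S] [DecidableEq S] (p : S → S → ℝ) (hpnn : ∀ x y, 0 ≤ p x y)
    (hprow : ∀ x, ∑ y, p x y = 1)
    (π : S → ℝ) (hπnn : ∀ x, 0 ≤ π x) (hπsum : ∑ x, π x = 1)
    (hstat : ∀ y, ∑ x, π x * p x y = π y)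
    (haper : ∃ m : ℕ, ∀ x y, 0 < (Matrix.of p ^ m) x y)
    (A B : S) (r : ℝ) (hr : r = π A * ∑ C, p A C * p C B) (hr0 : 0 ≤ r) (hr1 : r ≤ 1) :
    ∃ C : ℝ, 0 ≤ C ∧ ∀ n : ℕ, ∑ z, chainLaw π p n z * cenV A B r n z ^ 2 ≤ C * n := by
  have : Nonempty S := ⟨A⟩
  set g : S → ℝ := fun x => step3 p x (fun a b c => ind3 A B a b c + (-r)) with hg
  have hgx : ∀ x, g x = p x A * (∑ C, p A C * p C B) - r := by
    intro x
    simp only [hg]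
    rw [step3_add, step3_const p hprow, ← sub_eq_add_neg]
    congr 1
    unfold step3 ind3
    rw [Finset.sum_eq_single A]
    · congr 1
      apply Finset.sum_congr rfl
      intro b _
      simp
    · intro a _ ha
      simp [ha]
    · simp
  have hg0 : ∑ x, π x * g x = 0 := by
    simp_rw [hgx, mul_sub, Finset.sum_sub_distrib, ← mul_assoc, ← Finset.sum_mul]
    rw [hstat, hπsum, one_mul, ← hr, sub_self]
  obtain ⟨h, hh⟩ := aux_poisson p hprow π hπsum hstat haper g hg0
  obtain ⟨x0, hx0⟩ := Finite.exists_max (fun x => |h x|)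
  have hpois : ∀ x, h x = step3 p x (fun a b c => (ind3 A B a b c - r) + h c) := by
    intro x
    rw [step3_add, hh x]
    simp only [sub_eq_add_neg, hg]
  have h1 := aux_first_moment p hpnn hprow A B r h _ hx0 hpois
  have hK : ∀ n x, |pathE p n x (cenV A B r n)| ≤ 2 * |h x0| := by
    intro n x
    have a1 := h1 n x
    have a2 := hx0 x
    have := abs_add_le (pathE p n x (cenV A B r n) - h x) (h x)
    rw [sub_add_cancel] at this
    linarith
  refine ⟨1 + 2 * (2 * |h x0|), by positivity, fun n => ?_⟩
  rw [chain_eq_pathE π p hstat hπsum]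
  calc ∑ x, π x * pathE p n x (fun z => cenV A B r n z ^ 2)
      ≤ ∑ x, π x * ((1 + 2 * (2 * |h x0|)) * n) :=
        Finset.sum_le_sum fun x _ => mul_le_mul_of_nonneg_left
          (aux_second_moment p hpnn hprow A B r hr0 hr1 _ hK n x) (hπnn x)
    _ = _ := by rw [← Finset.sum_mul, hπsum, one_mul]

lemma aux_binom_rec (w : ℕ → ℝ) (q : ℝ) (hq0 : 0 < q) (hq1 : q < 1) (v : ℕ)
    (h : ∀ u < v, w u = (((u : ℝ) + 1) * (1 - q) / (((v : ℝ) - u) * q)) * w (u + 1)) :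
    ∀ u ≤ v, w u = (∑ k ∈ range (v + 1), w k) * ((v.choose u : ℝ) * q ^ u * (1 - q) ^ (v - u)) := by
  have hr0 : 0 < 1 - q := by linarith
  have h1 : ∀ u ≤ v, w u * (1 - q) ^ v = w 0 * ((v.choose u : ℝ) * q ^ u * (1 - q) ^ (v - u)) := by
    intro u
    induction u with
    | zero => intro _; simp
    | succ k ih =>
      intro hk
      have hkv : (0 : ℝ) < (v : ℝ) - k := by
        have : (k : ℝ) < v := by exact_mod_cast hk
        linarith
      have e1 := h k (by omega)
      have e2 := ih (by omega)
      have e3 : (v.choose (k + 1) : ℝ) * ((k : ℝ) + 1) = v.choose k * ((v : ℝ) - k) := by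
        have := Nat.choose_succ_right_eq v k
        have h4 : ((v - k : ℕ) : ℝ) = (v : ℝ) - k := Nat.cast_sub (by omega)
        rw [← h4]
        exact_mod_cast this
      have e4 : (1 - q) ^ (v - k) = (1 - q) ^ (v - (k + 1)) * (1 - q) := by
        rw [← pow_succ]; congr 1; omega
      rw [e1, e4] at e2
      have hk1 : (0 : ℝ) < (k : ℝ) + 1 := by positivity
      have e5 : w (k + 1) * (1 - q) ^ v * (((k : ℝ) + 1) * (1 - q)) =
          w 0 * ((v.choose k * ((v : ℝ) - k)) * q ^ (k + 1) * (1 - q) ^ (v - (k + 1))) * (1 - q) := by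
        field_simp at e2
        rw [pow_succ q k]
        linear_combination (1 - q) * e2
      rw [← e3] at e5
      have hne : ((k : ℝ) + 1) * (1 - q) ≠ 0 := by positivity
      apply mul_right_cancel₀ hne
      rw [e5]; ring
  have h2 : (∑ k ∈ range (v + 1), w k) * (1 - q) ^ v = w 0 := by
    rw [Finset.sum_mul]
    rw [Finset.sum_congr rfl (fun u hu => h1 u (by rw [Finset.mem_range] at hu; omega)),
      ← Finset.mul_sum]
    have : ∑ u ∈ range (v + 1), ((v.choose u : ℝ) * q ^ u * (1 - q) ^ (v - u)) = 1 := by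
      have h3 := add_pow q (1 - q) v
      rw [add_sub_cancel, one_pow] at h3
      refine Eq.trans ?_ h3.symm
      apply Finset.sum_congr rfl
      intro u _; ring
    rw [this, mul_one]
  intro u hu
  have h3 := h1 u hu
  rw [← h2] at h3
  have : (1 - q) ^ v ≠ 0 := by positivity
  apply mul_right_cancel₀ this
  rw [h3]; ring

lemma aux_window (u0 u1 : ℕ) (w bad l : ℕ → ℝ) (β t ε K μ bv : ℝ) (hβ : 0 < β) (ht : 0 ≤ t)
    (hε : 0 < ε) (hK : 0 ≤ K)
    (hw : ∀ u ∈ Icc u0 u1, β ≤ w u) (hbad : ∀ u, 0 ≤ bad u) (hbv : ∑ u ∈ Icc u0 u1, bad u ≤ bv)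
    (hinc : ∀ u ∈ Ico u0 u1, ε * w u - (ε + K) * bad u ≤ w u * (l (u + 1) - l u)) :
    ((u1 : ℝ) + 1 - u0) - (2 * t + (ε + K) * bv / β) / ε - 1
      ≤ (((Icc u0 u1).filter fun u => t ≤ |l u - μ|).card : ℝ) := by
  have hbv0 : 0 ≤ bv := (Finset.sum_nonneg fun u _ => hbad u).trans hbv
  have hcard := Finset.card_filter_add_card_filter_not (s := Icc u0 u1) (fun u => t ≤ |l u - μ|)
  set T := (Icc u0 u1).filter fun u => ¬ t ≤ |l u - μ| with hT
  have hIcc : ((u1 : ℝ) + 1 - u0) ≤ ((Icc u0 u1).card : ℝ) := by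
    rw [Nat.card_Icc]
    have : u1 + 1 ≤ (u1 + 1 - u0) + u0 := by omega
    have : ((u1 + 1 : ℕ) : ℝ) ≤ ((u1 + 1 - u0 : ℕ) : ℝ) + u0 := by exact_mod_cast this
    push_cast at this
    linarith
  have hcard' : (((Icc u0 u1).filter fun u => t ≤ |l u - μ|).card : ℝ) + T.card
      = (Icc u0 u1).card := by exact_mod_cast hcard
  suffices hTc : (T.card : ℝ) ≤ (2 * t + (ε + K) * bv / β) / ε + 1 by linarith
  rcases T.eq_empty_or_nonempty with he | hne
  · rw [he]; simp only [Finset.card_empty, Nat.cast_zero]; positivity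
  set a := T.min' hne
  set c := T.max' hne
  have ha : a ∈ T := T.min'_mem hne
  have hc : c ∈ T := T.max'_mem hne
  have hac : a ≤ c := T.min'_le c hc
  have hsub : T ⊆ Icc a c := fun x hx => Finset.mem_Icc.mpr ⟨T.min'_le x hx, T.le_max' x hx⟩
  have hTle : (T.card : ℝ) ≤ (c : ℝ) - a + 1 := by
    have := Finset.card_le_card hsub
    rw [Nat.card_Icc] at this
    have h2 : T.card + a ≤ c + 1 := by omega
    have : (T.card : ℝ) + a ≤ c + 1 := by exact_mod_cast h2
    linarith
  simp only [hT, Finset.mem_filter, Finset.mem_Icc, not_le] at ha hc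
  have tel : ∀ k, a ≤ k → k ≤ c →
      ε * ((k : ℝ) - a) - (ε + K) / β * ∑ u ∈ Ico a k, bad u ≤ l k - l a := by
    intro k hk
    induction k, hk using Nat.le_induction with
    | base => intro _; simp
    | succ k hk ih =>
      intro hkc
      have i1 := ih (by omega)
      rw [Finset.sum_Ico_succ_top hk]
      have i2 := hinc k (Finset.mem_Ico.mpr ⟨by omega, by omega⟩)
      have i3 := hw k (Finset.mem_Icc.mpr ⟨by omega, by omega⟩)
      have hwk : 0 < w k := lt_of_lt_of_le hβ i3
      have i4 : ε - (ε + K) / β * bad k ≤ l (k + 1) - l k := by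
        have : ε - (ε + K) * bad k / w k ≤ l (k + 1) - l k := by
          rw [← mul_le_mul_iff_right₀ hwk]
          refine le_trans (le_of_eq ?_) i2
          field_simp
        refine le_trans ?_ this
        have : (ε + K) * bad k / w k ≤ (ε + K) * bad k / β :=
          div_le_div_of_nonneg_left (mul_nonneg (by linarith) (hbad k)) hβ i3
        have e : (ε + K) * bad k / β = (ε + K) / β * bad k := by ring
        linarith
      push_cast
      rw [mul_add]
      linarith
  have hfin := tel c hac le_rfl
  have hsumle : ∑ u ∈ Ico a c, bad u ≤ bv := by
    refine (Finset.sum_le_sum_of_subset_of_nonneg ?_ (fun u _ _ => hbad u)).trans hbv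
    intro u hu
    rw [Finset.mem_Ico] at hu
    exact Finset.mem_Icc.mpr ⟨by omega, by omega⟩
  have h5 : (ε + K) / β * ∑ u ∈ Ico a c, bad u ≤ (ε + K) / β * bv :=
    mul_le_mul_of_nonneg_left hsumle (by positivity)
  have h6 : l c - l a ≤ 2 * t := by
    have x1 := (abs_lt.mp hc.2).2
    have x2 := (abs_lt.mp ha.2).1
    linarith
  have h7 : (c : ℝ) - a ≤ (2 * t + (ε + K) * bv / β) / ε := by
    rw [le_div_iff₀ hε]
    have e : (ε + K) * bv / β = (ε + K) / β * bv := by ring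
    rw [e]; linarith
  linarith

lemma aux_jensen {Ω : Type*} (s : Finset Ω) (P f : Ω → ℝ) (hP : ∀ z, 0 ≤ P z) (W : ℝ)
    (hW : ∑ z ∈ s, P z = W) (hW0 : 0 < W) (Φ : ℝ → ℝ) (hΦconv : ConvexOn ℝ (Set.Ici 0) Φ)
    (hΦmono : MonotoneOn Φ (Set.Ici 0)) (μ t : ℝ) (ht : 0 ≤ t)
    (htm : t ≤ |(∑ z ∈ s, P z * f z) / W - μ|) :
    W * Φ t ≤ ∑ z ∈ s, P z * Φ |f z - μ| := by
  have h1 := hΦconv.map_sum_le (t := s) (w := fun z => P z / W) (p := fun z => |f z - μ|)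
    (fun z _ => div_nonneg (hP z) hW0.le) (by rw [← Finset.sum_div, hW, div_self hW0.ne'])
    (fun z _ => Set.mem_Ici.mpr (abs_nonneg _))
  simp only [smul_eq_mul] at h1
  have h2 : t ≤ ∑ z ∈ s, P z / W * |f z - μ| := by
    refine htm.trans ?_
    have : (∑ z ∈ s, P z * f z) / W - μ = ∑ z ∈ s, P z / W * (f z - μ) := by
      simp_rw [mul_sub, Finset.sum_sub_distrib, ← Finset.sum_mul, ← Finset.sum_div, hW,
        div_self hW0.ne', one_mul, Finset.sum_div]
      congr 1
      apply Finset.sum_congr rfl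
      intro z _; ring
    rw [this]
    refine (Finset.abs_sum_le_sum_abs _ _).trans (le_of_eq ?_)
    apply Finset.sum_congr rfl
    intro z _
    rw [abs_mul, abs_of_nonneg (div_nonneg (hP z) hW0.le)]
  have h3 := (hΦmono ht (ht.trans h2) h2).trans h1
  have h4 := mul_le_mul_of_nonneg_left h3 hW0.le
  refine h4.trans (le_of_eq ?_)
  rw [Finset.mul_sum]
  apply Finset.sum_congr rfl
  intro z _
  field_simp

lemma chainLaw_nonneg {S : Type*} (π : S → ℝ) (p : S → S → ℝ) (hπ : ∀ x, 0 ≤ π x)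
    (hp : ∀ x y, 0 ≤ p x y) (n : ℕ) (z : Fin n → S) : 0 ≤ chainLaw π p n z := by
  unfold chainLaw
  split_ifs
  · exact mul_nonneg (hπ _) (Finset.prod_nonneg fun i _ => hp _ _)
  · exact zero_le_one

open Classical in
/-- the class `V = v` -/
def clsV {S : Type*} [Fintype S] (A B : S) (n v : ℕ) : Finset (Fin n → S) :=
  univ.filter fun z => (setT A B n z).card = v

lemma sum_clsV {S : Type*} [Fintype S] (A B D : S) (n v : ℕ) (F : (Fin n → S) → ℝ) :
    ∑ z ∈ clsV A B n v, F z = ∑ u ∈ range (v + 1), ∑ z ∈ cls A B D n u v, F z := by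
  classical
  rw [← Finset.sum_fiberwise_of_maps_to (s := clsV A B n v) (t := range (v + 1))
    (g := fun z => (setH A B D n z).card)]
  · apply Finset.sum_congr rfl
    intro u _
    apply Finset.sum_congr
    · ext z
      simp only [clsV, cls, Finset.mem_filter, Finset.mem_univ, true_and]
      tauto
    · intros; rfl
  · intro z hz
    simp only [clsV, Finset.mem_filter, Finset.mem_univ, true_and] at hz
    have := aux_card_add A B D n z
    rw [Finset.mem_range]; omega

lemma sum_allV {S : Type*} [Fintype S] (A B : S) (n : ℕ) (F : (Fin n → S) → ℝ) :
    ∑ z, F z = ∑ v ∈ range (n + 1), ∑ z ∈ clsV A B n v, F z := by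
  classical
  rw [← Finset.sum_fiberwise_of_maps_to (s := univ) (t := range (n + 1))
    (g := fun z => (setT A B n z).card)]
  · apply Finset.sum_congr rfl
    intro u _
    apply Finset.sum_congr
    · ext z
      simp only [clsV, Finset.mem_filter, Finset.mem_univ, true_and]
    · intros; rfl
  · intro z _
    have := Finset.card_le_univ (setT A B n z)
    rw [Fintype.card_fin] at this
    rw [Finset.mem_range]; omega

open Classical in
lemma aux_classV {S : Type*} [Fintype S] (π : S → ℝ) (p : S → S → ℝ) (hπ : ∀ x, 0 ≤ π x)
    (hp : ∀ x y, 0 ≤ p x y) (A B D : S)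
    (R q : ℝ) (hR : R = ∑ C, p A C * p C B) (hR0 : 0 < R) (hq : q = p A D * p D B / R)
    (hq0 : 0 < q) (hq1 : q < 1) (n v : ℕ) (L : (Fin n → S) → ℝ) (ε K : ℝ) (hε : 0 < ε) (hK : 0 ≤ K)
    (hLip : ∀ z, -K ≤ (∑ z', kernelR A B D n z z' * L z') - L z)
    (Φ : ℝ → ℝ) (hΦconv : ConvexOn ℝ (Set.Ici 0) Φ)
    (hΦmono : MonotoneOn Φ (Set.Ici 0)) (hΦnn : ∀ x : ℝ, 0 ≤ x → 0 ≤ Φ x) (μ t b η : ℝ)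
    (ht : 0 ≤ t) (hb : b = Real.sqrt (2 * Real.pi * q * (1 - q)) * Real.exp (1 / (2 * q * (1 - q))))
    (hη : η * (8 * (ε + K) * b) = ε)
    (hv1 : 16 ≤ Real.sqrt v) (hv2 : 1 / q ≤ Real.sqrt v) (hv3 : 1 / (1 - q) ≤ Real.sqrt v)
    (htv : 2 * t / ε ≤ Real.sqrt v / 4)
    (hw : 0 < ∑ z ∈ clsV A B n v, chainLaw π p n z)
    (hbad : ∑ z ∈ clsV A B n v, (if ε ≤ (∑ z', kernelR A B D n z z' * L z') - L z then 0 else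
      chainLaw π p n z) ≤ η * ∑ z ∈ clsV A B n v, chainLaw π p n z) :
    (∑ z ∈ clsV A B n v, chainLaw π p n z) / (2 * b) * Φ t ≤
      ∑ z ∈ clsV A B n v, chainLaw π p n z * Φ |L z - μ| := by
  set P := chainLaw π p n with hPdef
  have hP : ∀ z, 0 ≤ P z := chainLaw_nonneg π p hπ hp n
  set W := ∑ z ∈ clsV A B n v, P z with hWdef
  set w : ℕ → ℝ := fun u => ∑ z ∈ cls A B D n u v, P z with hwdef
  set bad : ℕ → ℝ := fun u => ∑ z ∈ cls A B D n u v,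
    (if ε ≤ (∑ z', kernelR A B D n z z' * L z') - L z then 0 else P z) with hbaddef
  set l : ℕ → ℝ := fun u => (∑ z ∈ cls A B D n u v, P z * L z) / w u with hldef
  have hr0 : 0 < 1 - q := by linarith
  have hb0 : 0 < b := by rw [hb]; positivity
  have hsv : 0 < Real.sqrt v := by linarith
  have hWs : W = ∑ u ∈ range (v + 1), w u := sum_clsV A B D n v _
  -- recursion
  have hker1 : ∀ u < v, ∀ z ∈ cls A B D n u v, ∑ z', kernelR A B D n z z' * (1 : ℝ) = 1 := by
    intro u hu z hz
    have hz' := hz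
    simp only [cls, Finset.mem_filter, Finset.mem_univ, true_and] at hz'
    have hc := aux_card_add A B D n z
    have hne : (setJ A B D n z).Nonempty := by
      rw [← Finset.card_pos]; omega
    rw [aux_kernel_sum A B D n z (fun _ => 1) hne, Finset.sum_const, nsmul_eq_mul, mul_one]
    apply div_self
    have : 0 < (setJ A B D n z).card := hne.card_pos
    positivity
  have hrec : ∀ u < v, w u = (((u : ℝ) + 1) * (1 - q) / (((v : ℝ) - u) * q)) * w (u + 1) := by
    intro u hu
    have := aux_transfer π p A B D R q hR hR0 hq hq0 n u v hu (fun _ => 1)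
    simp only [mul_one] at this
    have h1 : ∑ z ∈ cls A B D n u v, P z = ∑ z ∈ cls A B D n u v,
        P z * ∑ z', kernelR A B D n z z' := by
      apply Finset.sum_congr rfl
      intro z hz
      have := hker1 u hu z hz
      simp only [mul_one] at this
      rw [this, mul_one]
    simp only [hwdef]
    rw [h1]
    exact this
  have hbin := aux_binom_rec w q hq0 hq1 v hrec
  rw [← hWs] at hbin
  -- window
  have hv0 : (0 : ℝ) ≤ v := by positivity
  have hvs : Real.sqrt v * Real.sqrt v = v := Real.mul_self_sqrt hv0
  have hqv : Real.sqrt v ≤ q * v := by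
    rw [div_le_iff₀ hq0] at hv2
    nlinarith
  have hrv : Real.sqrt v ≤ (1 - q) * v := by
    rw [div_le_iff₀ hr0] at hv3
    nlinarith
  set u0 := ⌈q * v - Real.sqrt v / 2⌉₊ with hu0
  set u1 := ⌊q * v + Real.sqrt v / 2⌋₊ with hu1
  have hu0l : q * v - Real.sqrt v / 2 ≤ u0 := Nat.le_ceil _
  have hu0u : (u0 : ℝ) < q * v - Real.sqrt v / 2 + 1 := Nat.ceil_lt_add_one (by linarith)
  have hu1u : (u1 : ℝ) ≤ q * v + Real.sqrt v / 2 := Nat.floor_le (by positivity)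
  have hu1l : q * v + Real.sqrt v / 2 - 1 < u1 := by
    have := Nat.lt_floor_add_one (q * v + Real.sqrt v / 2)
    rw [← hu1] at this
    linarith
  have hu0pos : 1 ≤ u0 := by
    have : (0 : ℝ) < u0 := by linarith
    exact_mod_cast this
  have hu1v : u1 < v := by
    have : (u1 : ℝ) < v := by linarith
    exact_mod_cast this
  have hβ : 0 < W / (b * Real.sqrt v) := by positivity
  have hwβ : ∀ u ∈ Icc u0 u1, W / (b * Real.sqrt v) ≤ w u := by
    intro u hu
    rw [Finset.mem_Icc] at hu
    rw [hbin u (by omega), div_eq_mul_one_div, hb]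
    refine mul_le_mul_of_nonneg_left ?_ hw.le
    apply aux_binom_lower q hq0 hq1 v u (by omega) (by omega)
    have a1 : (u0 : ℝ) ≤ u := by exact_mod_cast hu.1
    have a2 : (u : ℝ) ≤ u1 := by exact_mod_cast hu.2
    rw [abs_le]
    constructor <;> linarith
  have hbadnn : ∀ u, 0 ≤ bad u := by
    intro u
    refine Finset.sum_nonneg fun z _ => ?_
    split_ifs
    · exact le_rfl
    · exact hP z
  have hIccsub : Icc u0 u1 ⊆ range (v + 1) := by
    intro u hu
    rw [Finset.mem_Icc] at hu
    rw [Finset.mem_range]; omega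
  have hbv : ∑ u ∈ Icc u0 u1, bad u ≤ η * W := by
    refine le_trans ?_ hbad
    rw [sum_clsV A B D n v]
    exact Finset.sum_le_sum_of_subset_of_nonneg hIccsub (fun u _ _ => hbadnn u)
  have hinc : ∀ u ∈ Ico u0 u1, ε * w u - (ε + K) * bad u ≤ w u * (l (u + 1) - l u) := by
    intro u hu
    rw [Finset.mem_Ico] at hu
    have huv : u < v := by omega
    have hwu : 0 < w u := lt_of_lt_of_le hβ (hwβ u (Finset.mem_Icc.mpr ⟨by omega, by omega⟩))
    have hwu1 : 0 < w (u + 1) :=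
      lt_of_lt_of_le hβ (hwβ (u + 1) (Finset.mem_Icc.mpr ⟨by omega, by omega⟩))
    have tr := aux_transfer π p A B D R q hR hR0 hq hq0 n u v huv L
    have hr := hrec u huv
    have e1 : w u * l u = ∑ z ∈ cls A B D n u v, P z * L z := by
      simp only [hldef]; field_simp
    have e2 : w u * l (u + 1) = ∑ z ∈ cls A B D n u v,
        P z * (∑ z', kernelR A B D n z z' * L z') := by
      rw [tr, hr]
      simp only [hldef]
      field_simp
      rfl
    rw [mul_sub, e1, e2, ← Finset.sum_sub_distrib]
    simp only [hwdef, hbaddef]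
    rw [Finset.mul_sum, Finset.mul_sum, ← Finset.sum_sub_distrib]
    apply Finset.sum_le_sum
    intro z _
    rw [← mul_sub]
    have hz := hP z
    split_ifs with hg
    · rw [mul_zero, sub_zero, mul_comm]
      exact mul_le_mul_of_nonneg_left hg hz
    · have := mul_le_mul_of_nonneg_left (hLip z) hz
      linarith
  have hwin := aux_window u0 u1 w bad l (W / (b * Real.sqrt v)) t ε K μ (η * W) hβ ht hε hK hwβ
    hbadnn hbv hinc
  have hcalc : (2 * t + (ε + K) * (η * W) / (W / (b * Real.sqrt v))) / ε
      = 2 * t / ε + Real.sqrt v / 8 := by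
    have : (ε + K) * (η * W) / (W / (b * Real.sqrt v)) = ε * Real.sqrt v / 8 := by
      have e : (ε + K) * (η * W) / (W / (b * Real.sqrt v)) =
        (η * (8 * (ε + K) * b)) * Real.sqrt v / 8 := by field_simp
      rw [e, hη]
    rw [this]; field_simp
  rw [hcalc] at hwin
  set G := (Icc u0 u1).filter fun u => t ≤ |l u - μ| with hG
  have hGcard : Real.sqrt v / 2 ≤ G.card := by linarith
  have hΦt := hΦnn t ht
  have hGle : ∀ u ∈ G, W / (b * Real.sqrt v) * Φ t ≤ ∑ z ∈ cls A B D n u v, P z * Φ |L z - μ| := by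
    intro u hu
    rw [hG, Finset.mem_filter] at hu
    have h1 := hwβ u hu.1
    have h2 := aux_jensen (cls A B D n u v) P L hP (w u) rfl (lt_of_lt_of_le hβ h1) Φ hΦconv
      hΦmono μ t ht hu.2
    exact (mul_le_mul_of_nonneg_right h1 hΦt).trans h2
  rw [sum_clsV A B D n v]
  have hsum1 : ∑ u ∈ G, ∑ z ∈ cls A B D n u v, P z * Φ |L z - μ| ≤
      ∑ u ∈ range (v + 1), ∑ z ∈ cls A B D n u v, P z * Φ |L z - μ| := by
    refine Finset.sum_le_sum_of_subset_of_nonneg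
      ((Finset.filter_subset _ _).trans hIccsub) (fun u _ _ => ?_)
    exact Finset.sum_nonneg fun z _ => mul_nonneg (hP z) (hΦnn _ (abs_nonneg _))
  refine le_trans ?_ hsum1
  refine le_trans ?_ (Finset.sum_le_sum hGle)
  rw [Finset.sum_const, nsmul_eq_mul]
  have h9 : W / (2 * b) * Φ t = Real.sqrt v / 2 * (W / (b * Real.sqrt v) * Φ t) := by
    field_simp
  rw [h9]
  exact mul_le_mul_of_nonneg_right hGcard (mul_nonneg hβ.le hΦt)

set_option maxHeartbeats 2000000

/-- let `Z` be (the first `n` terms of) a stationary aperiodic Markov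
chain on `𝔸 × 𝔸`, and `U`, `V`, `𝓡` as in the pairwise-Markov-chain construction with
states `𝐀, 𝐁, 𝐃`. Assume the random transformation `𝓡` satisfies (A1): there exist
`ε_o > 0` and `Δ_n → 0` with `P(E[L(𝓡(Z)) - L(Z) | Z] ≥ ε_o) ≥ 1 - Δ_n`. Then for every
convex nondecreasing `Φ : ℝ⁺ → ℝ⁺`, every sequence `μ_n` and every
`c_o ∈ (0, √(2α)/(8 b(q)))`, where `α = (1/3) P(Z₁ = 𝐀, Z₃ = 𝐁)` and
`b(q) = √(2πq(1-q)) exp(1/(2q(1-q)))`, for every sufficiently large `n`: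
`E Φ(|L(Z) - μ_n|) ≥ c_o Φ(ε_o √(2αn)/16)`. -/
theorem PMC_moment_lower_bound
    {𝔸 : Type*} [Fintype 𝔸] [DecidableEq 𝔸]
    (p : (𝔸 × 𝔸) → (𝔸 × 𝔸) → ℝ)
    (hpnn : ∀ x y, 0 ≤ p x y) (hprow : ∀ x, ∑ y, p x y = 1)
    (π : (𝔸 × 𝔸) → ℝ) (hπnn : ∀ x, 0 ≤ π x) (hπsum : ∑ x, π x = 1)
    (hstat : ∀ y, ∑ x, π x * p x y = π y)
    (haper : ∃ m : ℕ, ∀ x y, 0 < (Matrix.of p ^ m) x y)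
    (A B D : 𝔸 × 𝔸)
    (hAB : 0 < π A * ∑ C : 𝔸 × 𝔸, p A C * p C B)
    (q : ℝ) (hq : q = p A D * p D B / ∑ D' : 𝔸 × 𝔸, p A D' * p D' B)
    (hqpos : 0 < q)
    (Ssc : 𝔸 → 𝔸 → ℝ) (hSsc : ∀ a b, 0 ≤ Ssc a b) (δ : ℝ)
    -- assumption (A1)
    (ε : ℝ) (hε : 0 < ε)
    (Δ : ℕ → ℝ) (hΔ : Filter.Tendsto Δ Filter.atTop (nhds 0))
    (hA1 : ∀ n : ℕ, prOf (chainLaw π p n)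
        (fun z => ε ≤ (∑ z', kernelR A B D n z z' * scoreL Ssc δ n z')
          - scoreL Ssc δ n z) ≥ 1 - Δ n)
    -- the data of the conclusion
    (α : ℝ) (hα : α = (1 / 3) * (π A * ∑ C : 𝔸 × 𝔸, p A C * p C B))
    (Φ : ℝ → ℝ) (hΦconv : ConvexOn ℝ (Set.Ici 0) Φ)
    (hΦmono : MonotoneOn Φ (Set.Ici 0)) (hΦnn : ∀ x : ℝ, 0 ≤ x → 0 ≤ Φ x)
    (μ : ℕ → ℝ)
    (co : ℝ) (hco : 0 < co)
    (hco' : co < Real.sqrt (2 * α) /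
      (8 * (Real.sqrt (2 * Real.pi * q * (1 - q)) * Real.exp (1 / (2 * q * (1 - q)))))) :
    ∀ᶠ n in Filter.atTop,
      (∑ z, chainLaw π p n z * Φ |scoreL Ssc δ n z - μ n|)
        ≥ co * Φ (ε * Real.sqrt (2 * α * n) / 16) := by
  classical
  set R : ℝ := ∑ C : 𝔸 × 𝔸, p A C * p C B with hRdef
  have hR0 : 0 < R := by
    by_contra hcon
    have := mul_nonpos_of_nonneg_of_nonpos (hπnn A) (not_lt.mp hcon)
    linarith
  have hq1' : q ≤ 1 := by
    rw [hq, div_le_one hR0, hRdef]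
    exact Finset.single_le_sum (f := fun C => p A C * p C B)
      (fun C _ => mul_nonneg (hpnn _ _) (hpnn _ _)) (Finset.mem_univ D)
  have hq1 : q < 1 := by
    rcases hq1'.lt_or_eq with h | h
    · exact h
    · exfalso
      rw [h] at hco'
      norm_num at hco'
      linarith
  have hr0 : 0 < 1 - q := by linarith
  set b : ℝ := Real.sqrt (2 * Real.pi * q * (1 - q)) * Real.exp (1 / (2 * q * (1 - q))) with hb
  have hb0 : 0 < b := by positivity
  set r : ℝ := π A * R with hr
  have hp1 : ∀ x y, p x y ≤ 1 := fun x y => by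
    rw [← hprow x]
    exact Finset.single_le_sum (f := fun y => p x y) (fun C _ => hpnn _ _) (Finset.mem_univ y)
  have hR1 : R ≤ 1 := by
    rw [hRdef, ← hprow A]
    exact Finset.sum_le_sum fun C _ => mul_le_of_le_one_right (hpnn _ _) (hp1 _ _)
  have hπ1 : π A ≤ 1 := by
    rw [← hπsum]
    exact Finset.single_le_sum (f := π) (fun C _ => hπnn _) (Finset.mem_univ A)
  have hr1 : r ≤ 1 := mul_le_one₀ hπ1 hR0.le hR1
  have hα0 : 0 < α := by rw [hα]; linarith
  have hα1 : α ≤ 1 / 3 := by rw [hα]; linarith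
  have hrα : r = 3 * α := by rw [hα]; ring
  -- bound on single changes
  set K0 : ℝ := ∑ x : 𝔸 × 𝔸, Ssc x.1 x.2 with hK0
  have hSK : ∀ a c, Ssc a c ≤ K0 := fun a c =>
    Finset.single_le_sum (f := fun x : 𝔸 × 𝔸 => Ssc x.1 x.2) (fun x _ => hSsc _ _)
      (Finset.mem_univ (a, c))
  have hK00 : 0 ≤ K0 := Finset.sum_nonneg fun x _ => hSsc _ _
  set K : ℝ := 2 * K0 with hKdef
  have hKnn : 0 ≤ K := by positivity
  have hLip : ∀ (n : ℕ) (z : Fin n → 𝔸 × 𝔸), -K ≤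
      (∑ z', kernelR A B D n z z' * scoreL Ssc δ n z') - scoreL Ssc δ n z := by
    intro n z
    by_cases hJ : (setJ A B D n z).Nonempty
    · rw [aux_kernel_sum A B D n z _ hJ]
      have hc : (0 : ℝ) < (setJ A B D n z).card := by exact_mod_cast hJ.card_pos
      have : scoreL Ssc δ n z - K ≤ (∑ i ∈ setJ A B D n z,
          scoreL Ssc δ n (Function.update z (posM n i) D)) / (setJ A B D n z).card := by
        rw [le_div_iff₀ hc, mul_comm, ← nsmul_eq_mul]
        exact Finset.card_nsmul_le_sum _ _ _ fun i _ =>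
          aux_score_lip Ssc δ n K0 hSK hSsc hK00 z (posM n i) D
      linarith
    · rw [aux_kernel_sum_empty A B D n z _ hJ]; linarith
  obtain ⟨C, hC0, hC⟩ := aux_lln p hpnn hprow π hπnn hπsum hstat haper A B r hr hAB.le hr1
  set η : ℝ := ε / (8 * (ε + K) * b) with hη
  have hη0 : 0 < η := by positivity
  have hη' : η * (8 * (ε + K) * b) = ε := by rw [hη]; field_simp
  set v0 : ℝ := 16 + 1 / q + 1 / (1 - q) with hv0
  -- eventual conditions
  have ev1 : ∀ᶠ n : ℕ in Filter.atTop, Δ n < η / 4 :=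
    hΔ.eventually (gt_mem_nhds (by positivity))
  have ev2 : ∀ᶠ n : ℕ in Filter.atTop, 2 * v0 ^ 2 / α ≤ (n : ℝ) :=
    tendsto_natCast_atTop_atTop.eventually (Filter.eventually_ge_atTop _)
  have ev3 : ∀ᶠ n : ℕ in Filter.atTop, 64 * C / α ^ 2 ≤ (n : ℝ) :=
    tendsto_natCast_atTop_atTop.eventually (Filter.eventually_ge_atTop _)
  have ev4 : ∀ᶠ n : ℕ in Filter.atTop, (8 : ℝ) ≤ (n : ℝ) :=
    tendsto_natCast_atTop_atTop.eventually (Filter.eventually_ge_atTop _)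
  filter_upwards [ev1, ev2, ev3, ev4] with n h1 h2 h3 h4
  have hn0 : (0 : ℝ) < n := by linarith
  set L := scoreL Ssc δ n with hL
  set P := chainLaw π p n with hPdef
  have hP : ∀ z, 0 ≤ P z := chainLaw_nonneg π p hπnn hpnn n
  have hP1 : ∑ z, P z = 1 := by
    have := chain_eq_pathE π p hstat hπsum n (fun _ => 1)
    simp only [mul_one, pathE_const p hprow] at this
    rw [← hπsum]; exact this
  set t : ℝ := ε * Real.sqrt (2 * α * n) / 16 with ht
  have ht0 : 0 ≤ t := by positivity
  have hΦt := hΦnn t ht0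
  set bd : (Fin n → 𝔸 × 𝔸) → ℝ := fun z =>
    if ε ≤ (∑ z', kernelR A B D n z z' * L z') - L z then 0 else P z with hbd
  have hbd0 : ∀ z, 0 ≤ bd z := by
    intro z
    simp only [hbd]
    split_ifs
    · exact le_rfl
    · exact hP z
  have hbdsum : ∑ z, bd z ≤ Δ n := by
    have h := hA1 n
    unfold prOf at h
    have e : (∑ z, bd z) + (∑ z, if ε ≤ (∑ z', kernelR A B D n z z' * L z') - L z then P z else 0)
        = 1 := by
      rw [← Finset.sum_add_distrib, ← hP1]
      apply Finset.sum_congr rfl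
      intro z _
      simp only [hbd]
      split_ifs <;> simp
    have h' : (∑ z, if ε ≤ (∑ z', kernelR A B D n z z' * L z') - L z then P z else 0)
        ≥ 1 - Δ n := by
      refine h.trans (le_of_eq ?_)
      apply Finset.sum_congr rfl
      intro z _
      congr 1
    linarith
  -- small V
  set sm : (Fin n → 𝔸 × 𝔸) → ℝ := fun z =>
    if ((setT A B n z).card : ℝ) < α * n / 2 then P z else 0 with hsm
  have hsmsum : ∑ z, sm z ≤ 1 / 4 := by
    have hx : α * n / 4 ≤ r * (n / 3 : ℕ) - α * n / 2 := by
      have hN : (n : ℝ) - 2 ≤ 3 * (n / 3 : ℕ) := by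
        have : n ≤ 3 * (n / 3) + 2 := by omega
        have : (n : ℝ) ≤ 3 * (n / 3 : ℕ) + 2 := by exact_mod_cast this
        linarith
      have := mul_le_mul_of_nonneg_left hN hα0.le
      rw [hrα]
      nlinarith
    have hx0 : 0 < α * n / 4 := by positivity
    have hle : ∀ z, sm z * (α * n / 4) ^ 2 ≤ P z * cenV A B r n z ^ 2 := by
      intro z
      simp only [hsm]
      split_ifs with hz
      · apply mul_le_mul_of_nonneg_left _ (hP z)
        unfold cenV
        rw [← neg_sq ((((setT A B n z).card : ℝ)) - _)]
        apply pow_le_pow_left₀ hx0.le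
        linarith
      · rw [zero_mul]; exact mul_nonneg (hP z) (sq_nonneg _)
    have hs := Finset.sum_le_sum (s := univ) fun z _ => hle z
    rw [← Finset.sum_mul] at hs
    have hs2 := hs.trans (hC n)
    rw [div_le_iff₀ (by positivity)] at h3
    have : C * n ≤ 1 / 4 * (α * n / 4) ^ 2 := by nlinarith
    exact le_of_mul_le_mul_right (hs2.trans this) (by positivity)
  -- per-class bound
  have hcls : ∀ v ∈ range (n + 1),
      Φ t / (2 * b) * (∑ z ∈ clsV A B n v, P z - ∑ z ∈ clsV A B n v, sm z
        - (∑ z ∈ clsV A B n v, bd z) / η) ≤ ∑ z ∈ clsV A B n v, P z * Φ |L z - μ n| := by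
    intro v _
    have hrhs : 0 ≤ ∑ z ∈ clsV A B n v, P z * Φ |L z - μ n| :=
      Finset.sum_nonneg fun z _ => mul_nonneg (hP z) (hΦnn _ (abs_nonneg _))
    have hbdv : 0 ≤ ∑ z ∈ clsV A B n v, bd z := Finset.sum_nonneg fun z _ => hbd0 z
    have hPv : 0 ≤ ∑ z ∈ clsV A B n v, P z := Finset.sum_nonneg fun z _ => hP z
    have hbdη : 0 ≤ (∑ z ∈ clsV A B n v, bd z) / η := by positivity
    have hfac : 0 ≤ Φ t / (2 * b) := by positivity
    by_cases hv : (v : ℝ) < α * n / 2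
    · have : ∑ z ∈ clsV A B n v, sm z = ∑ z ∈ clsV A B n v, P z := by
        apply Finset.sum_congr rfl
        intro z hz
        simp only [clsV, Finset.mem_filter, Finset.mem_univ, true_and] at hz
        simp only [hsm, hz, if_pos hv]
      rw [this, sub_self]
      exact (mul_nonpos_of_nonneg_of_nonpos hfac (by linarith)).trans hrhs
    have hsm0 : ∑ z ∈ clsV A B n v, sm z = 0 := by
      apply Finset.sum_eq_zero
      intro z hz
      simp only [clsV, Finset.mem_filter, Finset.mem_univ, true_and] at hz
      simp only [hsm, hz, if_neg hv]
    rw [hsm0, sub_zero]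
    by_cases hbv : ∑ z ∈ clsV A B n v, bd z ≤ η * ∑ z ∈ clsV A B n v, P z
    · rcases hPv.lt_or_eq with hpos | hzero
      · have hvn : α * n / 2 ≤ v := not_lt.mp hv
        have hv0v : v0 ^ 2 ≤ v := by
          rw [div_le_iff₀ hα0] at h2
          linarith
        have hi1 : 0 < 1 / q := by positivity
        have hi2 : 0 < 1 / (1 - q) := by positivity
        have hsv : v0 ≤ Real.sqrt v := Real.le_sqrt_of_sq_le hv0v
        have htv : 2 * t / ε ≤ Real.sqrt v / 4 := by
          have e : 2 * t / ε = Real.sqrt (2 * α * n) / 8 := by rw [ht]; field_simp; ring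
          have e2 : Real.sqrt (2 * α * n) ≤ 2 * Real.sqrt v := by
            rw [Real.sqrt_le_left (by positivity), mul_pow, Real.sq_sqrt (by positivity)]
            linarith
          rw [e]; linarith
        have := aux_classV π p hπnn hpnn A B D R q hRdef hR0 hq hqpos hq1 n v L ε K hε hKnn
          (hLip n) Φ hΦconv hΦmono hΦnn (μ n) t b η ht0 hb hη' (by linarith) (by linarith)
          (by linarith) htv hpos hbv
        refine le_trans ?_ this
        have e : (∑ z ∈ clsV A B n v, P z) / (2 * b) * Φ t
          = Φ t / (2 * b) * ∑ z ∈ clsV A B n v, P z := by ring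
        rw [e]
        exact mul_le_mul_of_nonneg_left (by linarith) hfac
      · rw [← hzero]
        exact (mul_nonpos_of_nonneg_of_nonpos hfac (by linarith)).trans hrhs
    · have : ∑ z ∈ clsV A B n v, P z ≤ (∑ z ∈ clsV A B n v, bd z) / η := by
        rw [le_div_iff₀ hη0]; linarith
      exact (mul_nonpos_of_nonneg_of_nonpos hfac (by linarith)).trans hrhs
  have htot := Finset.sum_le_sum hcls
  rw [← Finset.mul_sum, Finset.sum_sub_distrib, Finset.sum_sub_distrib, ← Finset.sum_div,
    ← sum_allV A B n, ← sum_allV A B n, ← sum_allV A B n, ← sum_allV A B n, hP1] at htot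
  refine le_trans ?_ htot
  have hbη : (∑ z, bd z) / η ≤ 1 / 4 := by
    rw [div_le_iff₀ hη0]; linarith
  have hhalf : (1 : ℝ) / 2 ≤ 1 - ∑ z, sm z - (∑ z, bd z) / η := by linarith
  have hco1 : co ≤ 1 / (2 * b) * (1 / 2) := by
    have hs1 : Real.sqrt (2 * α) ≤ 1 := by
      exact Real.sqrt_le_iff.mpr ⟨by norm_num, by linarith⟩
    have : Real.sqrt (2 * α) / (8 * b) ≤ 1 / (8 * b) := by gcongr
    have e : 1 / (2 * b) * (1 / 2) = 2 * (1 / (8 * b)) := by field_simp; norm_num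
    have : 0 < 1 / (8 * b) := by positivity
    linarith
  calc co * Φ t ≤ 1 / (2 * b) * (1 / 2) * Φ t := mul_le_mul_of_nonneg_right hco1 hΦt
    _ = Φ t / (2 * b) * (1 / 2) := by ring
    _ ≤ _ := mul_le_mul_of_nonneg_left hhalf (by positivity)
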